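/- arXiv:math/0601533 — 2 statements merged into one kernel-verified Lean document; each statement's English description precedes it below -/
import Mathlib

section
/- Suppose α1 + α2 + β1 + β2 + δ1 + δ2 ≠ 3γ, and suppose the algebra A(Ẽ6,χ) admits an irreducible non-degenerate *-representation in generalized dimension n = (n1,n2,n3,n4,n5,n6,n0). Then, after applying a suitable permutation of the three branch pairs — i.e. permuting the three ordered pairs (n1,n2), (n3,n4), (n5,n6) among the three branch slots (keeping n0 fixed) — the resulting generalized dimension equals M_d d_k for some d_k from one of the following three families: Family I: v_1 = (1,0,0,0,0,0,0), v_2 = (1,1,0,0,0,0,0), v_3 = (0,1,0,0,0,0,1), v_4 = (0,0,0,1,0,1,1), v_5 = (0,0,1,1,1,1,1), v_6 = (0,1,1,1,1,1,1), v_7 = (1,1,0,1,0,1,2), v_8 = (1,2,0,1,0,1,2), v_9 = (1,2,1,1,1,1,2), v_10 = (1,1,1,2,1,2,2), v_11 = (0,1,1,2,1,2,3), v_12 = (0,2,1,2,1,2,3), d_k = v_r + qδ for k = 12q + r, 1 ≤ r ≤ 12, k ≥ 15; Family II: v_1 = (0,1,0,0,0,0,0), v_2 = (1,1,0,0,0,0,1),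 v_3 = (1,1,0,1,0,1,1), v_4 = (0,1,1,1,1,1,2), v_5 = (0,1,1,2,1,2,2), v_6 = (1,1,1,2,1,2,3), d_k = v_r + qδ for k = 6q + r, 1 ≤ r ≤ 6, k ≥ 8; Family III: v_1 = (0,0,0,0,0,0,1), v_2 = (0,1,0,1,0,1,1), v_3 = (1,1,1,1,1,1,2), v_4 = (1,2,1,2,1,2,2), d_k = v_r + qδ for k = 4q + r, 1 ≤ r ≤ 4, k ≥ 5. -/
open Matrix

noncomputable section

/-- A self-adjoint idempotent complex matrix (an orthogonal projection). -/
def IsProjection {m : ℕ} (P : Matrix (Fin m) (Fin m) ℂ) : Prop :=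
  P.IsHermitian ∧ P * P = P

/-- A *-representation of the algebra `A(Ẽ6, χ)`, `χ = (α1,α2,β1,β2,δ1,δ2,γ)`, in
generalized dimension `n = (n1,…,n6,n0)` (so `n 6` is `n0`): six orthogonal
projections on `ℂ^{n0}` with the prescribed ranks, orthogonal in pairs, whose
weighted sum is `γ·I`. -/
def IsRepE6 (α1 α2 β1 β2 δ1 δ2 γ : ℝ) (n : Fin 7 → ℕ)
    (P1 P2 Q1 Q2 S1 S2 : Matrix (Fin (n 6)) (Fin (n 6)) ℂ) : Prop :=
  IsProjection P1 ∧ IsProjection P2 ∧ IsProjection Q1 ∧ IsProjection Q2 ∧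
  IsProjection S1 ∧ IsProjection S2 ∧
  P1 * P2 = 0 ∧ Q1 * Q2 = 0 ∧ S1 * S2 = 0 ∧
  P1.rank = n 0 ∧ P2.rank = n 1 ∧ Q1.rank = n 2 ∧ Q2.rank = n 3 ∧
  S1.rank = n 4 ∧ S2.rank = n 5 ∧
  (α1 : ℂ) • P1 + (α2 : ℂ) • P2 + (β1 : ℂ) • Q1 + (β2 : ℂ) • Q2 +
      (δ1 : ℂ) • S1 + (δ2 : ℂ) • S2 = (γ : ℂ) • (1 : Matrix (Fin (n 6)) (Fin (n 6)) ℂ)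

/-- Non-degeneracy: none of the three pairs of projections sums to the identity. -/
def IsNondegRep {m : ℕ} (P1 P2 Q1 Q2 S1 S2 : Matrix (Fin m) (Fin m) ℂ) : Prop :=
  P1 + P2 ≠ 1 ∧ Q1 + Q2 ≠ 1 ∧ S1 + S2 ≠ 1

/-- Irreducibility: only scalar matrices commute with all six projections. -/
def IsIrredRep {m : ℕ} (P1 P2 Q1 Q2 S1 S2 : Matrix (Fin m) (Fin m) ℂ) : Prop :=
  ∀ X : Matrix (Fin m) (Fin m) ℂ,
    X * P1 = P1 * X → X * P2 = P2 * X → X * Q1 = Q1 * X → X * Q2 = Q2 * X →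
    X * S1 = S1 * X → X * S2 = S2 * X → ∃ c : ℂ, X = c • (1 : Matrix (Fin m) (Fin m) ℂ)

/-- Existence of an irreducible non-degenerate *-representation of `A(Ẽ6,χ)`
in generalized dimension `n` (a tuple of positive integers). -/
def HasIrrNondegRep (α1 α2 β1 β2 δ1 δ2 γ : ℝ) (n : Fin 7 → ℕ) : Prop :=
  (∀ i, 0 < n i) ∧
  ∃ P1 P2 Q1 Q2 S1 S2 : Matrix (Fin (n 6)) (Fin (n 6)) ℂ,
    IsRepE6 α1 α2 β1 β2 δ1 δ2 γ n P1 P2 Q1 Q2 S1 S2 ∧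
    IsNondegRep P1 P2 Q1 Q2 S1 S2 ∧ IsIrredRep P1 P2 Q1 Q2 S1 S2

/-- The matrix of the odd Coxeter map `∙c` of `Ẽ6` (coordinates `(x1,…,x6,x0)`):
`∙c(x) = (x2−x1, x2, x4−x3, x4, x6−x5, x6, x2+x4+x6−x0)`. -/
def cOddM : Matrix (Fin 7) (Fin 7) ℝ :=
  !![-1, 1, 0, 0, 0, 0, 0;
      0, 1, 0, 0, 0, 0, 0;
      0, 0, -1, 1, 0, 0, 0;
      0, 0, 0, 1, 0, 0, 0;
      0, 0, 0, 0, -1, 1, 0;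
      0, 0, 0, 0, 0, 1, 0;
      0, 1, 0, 1, 0, 1, -1]

/-- The matrix of the even Coxeter map `∘c` of `Ẽ6`:
`∘c(x) = (x1, x1+x0−x2, x3, x3+x0−x4, x5, x5+x0−x6, x0)`. -/
def cEvenM : Matrix (Fin 7) (Fin 7) ℝ :=
  !![1, 0, 0, 0, 0, 0, 0;
     1, -1, 0, 0, 0, 0, 1;
     0, 0, 1, 0, 0, 0, 0;
     0, 0, 1, -1, 0, 0, 1;
     0, 0, 0, 0, 1, 0, 0;
     0, 0, 0, 0, 1, -1, 1;
     0, 0, 0, 0, 0, 0, 1]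

/-- The Coxeter transformation `C = ∙c ∘ ∘c` (first `∘c`, then `∙c`). -/
def coxC : Matrix (Fin 7) (Fin 7) ℝ := cOddM * cEvenM

/-- The matrix `M_f` sending `χ = (α1,α2,β1,β2,δ1,δ2,γ)` to
`(α1−α2, α1, β1−β2, β1, δ1−δ2, δ1, γ)`. -/
def MfM : Matrix (Fin 7) (Fin 7) ℝ :=
  !![1, -1, 0, 0, 0, 0, 0;
     1, 0, 0, 0, 0, 0, 0;
     0, 0, 1, -1, 0, 0, 0;
     0, 0, 1, 0, 0, 0, 0;
     0, 0, 0, 0, 1, -1, 0;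
     0, 0, 0, 0, 1, 0, 0;
     0, 0, 0, 0, 0, 0, 1]

/-- The integer matrix `M_d` sending `d = (d1,d2,d3,d4,d5,d6,d0)` to
`(d2−d1, d1, d4−d3, d3, d6−d5, d5, d0)`. -/
def MdZ : Matrix (Fin 7) (Fin 7) ℤ :=
  !![-1, 1, 0, 0, 0, 0, 0;
      1, 0, 0, 0, 0, 0, 0;
      0, 0, -1, 1, 0, 0, 0;
      0, 0, 1, 0, 0, 0, 0;
      0, 0, 0, 0, -1, 1, 0;
      0, 0, 0, 0, 1, 0, 0;
      0, 0, 0, 0, 0, 0, 1]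

/-- The minimal imaginary root `δ = (1,2,1,2,1,2,3)` of `Ẽ6`, over `ℤ`. -/
def deltaZ : Fin 7 → ℤ := ![1, 2, 1, 2, 1, 2, 3]

/-- `v ⪰ 0` : the first six coordinates are strictly positive and the seventh is zero. -/
def PosVec (v : Fin 7 → ℝ) : Prop := (∀ i : Fin 7, i ≠ 6 → 0 < v i) ∧ v 6 = 0

end

noncomputable section

/-- The vectors `v_1,…,v_12` of Family I. -/
def vFamI : Fin 12 → (Fin 7 → ℤ) :=
  ![![1,0,0,0,0,0,0], ![1,1,0,0,0,0,0], ![0,1,0,0,0,0,1], ![0,0,0,1,0,1,1],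
    ![0,0,1,1,1,1,1], ![0,1,1,1,1,1,1], ![1,1,0,1,0,1,2], ![1,2,0,1,0,1,2],
    ![1,2,1,1,1,1,2], ![1,1,1,2,1,2,2], ![0,1,1,2,1,2,3], ![0,2,1,2,1,2,3]]

/-- Family I: `d_k = v_r + qδ`, where `k = 12q + r` with `1 ≤ r ≤ 12`. -/
def dFamI (k : ℕ) : Fin 7 → ℤ :=
  vFamI ⟨(k - 1) % 12, Nat.mod_lt _ (by norm_num)⟩ + (((k - 1) / 12 : ℕ) : ℤ) • deltaZ

/-- The vectors `v_1,…,v_6` of Family II. -/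
def vFamII : Fin 6 → (Fin 7 → ℤ) :=
  ![![0,1,0,0,0,0,0], ![1,1,0,0,0,0,1], ![1,1,0,1,0,1,1],
    ![0,1,1,1,1,1,2], ![0,1,1,2,1,2,2], ![1,1,1,2,1,2,3]]

/-- Family II: `d_k = v_r + qδ`, where `k = 6q + r` with `1 ≤ r ≤ 6`. -/
def dFamII (k : ℕ) : Fin 7 → ℤ :=
  vFamII ⟨(k - 1) % 6, Nat.mod_lt _ (by norm_num)⟩ + (((k - 1) / 6 : ℕ) : ℤ) • deltaZ

/-- The vectors `v_1,…,v_4` of Family III. -/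
def vFamIII : Fin 4 → (Fin 7 → ℤ) :=
  ![![0,0,0,0,0,0,1], ![0,1,0,1,0,1,1], ![1,1,1,1,1,1,2], ![1,2,1,2,1,2,2]]

/-- Family III: `d_k = v_r + qδ`, where `k = 4q + r` with `1 ≤ r ≤ 4`. -/
def dFamIII (k : ℕ) : Fin 7 → ℤ :=
  vFamIII ⟨(k - 1) % 4, Nat.mod_lt _ (by norm_num)⟩ + (((k - 1) / 4 : ℕ) : ℤ) • deltaZ

/-- Permuting the three branch pairs `(n1,n2)`, `(n3,n4)`, `(n5,n6)` of a
generalized dimension vector `n = (n1,…,n6,n0)` by a permutation `σ` of the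
three branch slots, keeping the central component `n0` fixed. -/
def permDim (σ : Equiv.Perm (Fin 3)) (n : Fin 7 → ℕ) : Fin 7 → ℕ :=
  ![n ⟨2 * (σ 0).val, by have := (σ 0).isLt; omega⟩,
    n ⟨2 * (σ 0).val + 1, by have := (σ 0).isLt; omega⟩,
    n ⟨2 * (σ 1).val, by have := (σ 1).isLt; omega⟩,
    n ⟨2 * (σ 1).val + 1, by have := (σ 1).isLt; omega⟩,
    n ⟨2 * (σ 2).val, by have := (σ 2).isLt; omega⟩,
    n ⟨2 * (σ 2).val + 1, by have := (σ 2).isLt; omega⟩,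
    n 6]

section Bricks

open Module

variable {K V : Type*} [Field K] [AddCommGroup V] [Module K V]

/-- Three two-step flags `p ≤ p'`, `q ≤ q'`, `s ≤ s'` form a brick if only the scalars
preserve all six subspaces. -/
def IsBrick (p p' q q' s s' : Submodule K V) : Prop :=
  ∀ X : V →ₗ[K] V, p ≤ p.comap X → p' ≤ p'.comap X → q ≤ q.comap X → q' ≤ q'.comap X →
    s ≤ s.comap X → s' ≤ s'.comap X → ∃ c : K, X = c • LinearMap.id

theorem IsBrick.swap₁₂ {p p' q q' s s' : Submodule K V} (h : IsBrick p p' q q' s s') :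
    IsBrick q q' p p' s s' :=
  fun X h1 h2 h3 h4 h5 h6 => h X h3 h4 h1 h2 h5 h6

theorem IsBrick.swap₂₃ {p p' q q' s s' : Submodule K V} (h : IsBrick p p' q q' s s') :
    IsBrick p p' s s' q q' :=
  fun X h1 h2 h3 h4 h5 h6 => h X h1 h2 h5 h6 h3 h4

theorem le_comap_smulRight {U p : Submodule K V} {f : V →ₗ[K] K} {w : V}
    (hf : U ≤ LinearMap.ker f) (h : w ∈ p ∨ p ≤ U) :
    p ≤ p.comap (f.smulRight w + (0 : V →ₗ[K] K).smulRight 0) := by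
  intro y hy
  rw [Submodule.mem_comap]
  rcases h with h | h
  · simpa using p.smul_mem (f y) h
  · have : f y = 0 := hf (h hy)
    simp [this]

theorem exists_mem_ne_zero_of_finrank_pos {A : Submodule K V} (h : 0 < finrank K A) :
    ∃ w ∈ A, w ≠ 0 := by
  refine Submodule.exists_mem_ne_zero_of_ne_bot ?_
  rintro rfl
  simp at h

theorem linearIndependent_pair_of_add_mem {A B C : Submodule K V} {u v : V} (hu : u ∈ A)
    (hv : v ∈ B) (huv : u + v ∈ C) (h0 : u ≠ 0 ∨ v ≠ 0) (hAB : ∀ w ∈ A, w ∈ B → w = 0)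
    (hAC : ∀ w ∈ A, w ∈ C → w = 0) (hBC : ∀ w ∈ B, w ∈ C → w = 0) :
    LinearIndependent K ![u, v] := by
  have hv0 : v ≠ 0 := by
    rintro rfl
    exact h0.elim (fun h => h (hAC u hu (by simpa using huv))) (fun h => h rfl)
  have hu0 : u ≠ 0 := by
    rintro rfl
    exact hv0 (hBC v hv (by simpa using huv))
  rw [LinearIndependent.pair_iff' hu0]
  rintro a rfl
  exact hv0 (hAB _ (A.smul_mem a hu) hv)

variable [FiniteDimensional K V]

theorem smulRight_add_smulRight_eq_zero_of_eq_smul_id (hV : 2 < finrank K V)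
    (f g : V →ₗ[K] K) (u v : V) {c : K}
    (hc : f.smulRight u + g.smulRight v = c • LinearMap.id) :
    f.smulRight u + g.smulRight v = 0 := by
  have hker : LinearMap.ker (f.prod g) ≠ ⊥ := LinearMap.ker_ne_bot_of_finrank_lt (by simpa using hV)
  obtain ⟨y, hy, hy0⟩ := Submodule.exists_mem_ne_zero_of_ne_bot hker
  rw [LinearMap.ker_prod, Submodule.mem_inf, LinearMap.mem_ker, LinearMap.mem_ker] at hy
  have h := LinearMap.congr_fun hc y
  simp only [LinearMap.add_apply, LinearMap.smulRight_apply, hy.1, hy.2, zero_smul, add_zero,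
    LinearMap.smul_apply, LinearMap.id_apply] at h
  rcases smul_eq_zero.1 h.symm with h | h
  · rw [hc, h, zero_smul]
  · exact absurd h hy0

/-- A brick has no nonzero endomorphism of rank one: if `U` is a proper subspace and each of the
six subspaces contains `w` or is contained in `U`, then `w = 0`. -/
theorem IsBrick.eq_zero {p p' q q' s s' : Submodule K V} (h : IsBrick p p' q q' s s')
    (hV : 2 < finrank K V) (U : Submodule K V) (hU : finrank K U < finrank K V) (w : V)
    (hp : w ∈ p ∨ p ≤ U) (hp' : w ∈ p' ∨ p' ≤ U) (hq : w ∈ q ∨ q ≤ U) (hq' : w ∈ q' ∨ q' ≤ U)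
    (hs : w ∈ s ∨ s ≤ U) (hs' : w ∈ s' ∨ s' ≤ U) : w = 0 := by
  have hlt : U < ⊤ := lt_top_iff_ne_top.2 (by rintro rfl; simp at hU)
  obtain ⟨f, hf0, hf⟩ := U.exists_le_ker_of_lt_top hlt
  obtain ⟨c, hc⟩ := h (f.smulRight w + (0 : V →ₗ[K] K).smulRight 0)
    (le_comap_smulRight hf hp) (le_comap_smulRight hf hp') (le_comap_smulRight hf hq)
    (le_comap_smulRight hf hq') (le_comap_smulRight hf hs) (le_comap_smulRight hf hs')
  have h0 := smulRight_add_smulRight_eq_zero_of_eq_smul_id hV f 0 w 0 hc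
  obtain ⟨y, hy⟩ : ∃ y, f y ≠ 0 := by
    by_contra! hcon
    exact hf0 (LinearMap.ext hcon)
  have := LinearMap.congr_fun h0 y
  simpa [hy] using this

theorem finrank_add_le_finrank_inf_add (A B : Submodule K V) :
    finrank K A + finrank K B ≤ finrank K (A ⊓ B : Submodule K V) + finrank K V := by
  have h1 := Submodule.finrank_sup_add_finrank_inf_eq A B
  have h2 := Submodule.finrank_le (A ⊔ B)
  omega

theorem finrank_sup_le_add (A B : Submodule K V) :
    finrank K (A ⊔ B : Submodule K V) ≤ finrank K A + finrank K B :=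
  Submodule.finrank_add_le_finrank_add_finrank A B

/-- If three subspaces of `W` have total dimension exceeding that of `W`, there are vectors of the
first two, not both zero, whose sum lies in the third. -/
theorem exists_add_mem_of_finrank_lt {A B C W : Submodule K V} (hA : A ≤ W) (hB : B ≤ W)
    (hC : C ≤ W) (h : finrank K W < finrank K A + finrank K B + finrank K C) :
    ∃ u ∈ A, ∃ v ∈ B, u + v ∈ C ∧ (u ≠ 0 ∨ v ≠ 0) := by
  by_cases hAB : A ⊓ B = ⊥
  · have h1 := Submodule.finrank_sup_add_finrank_inf_eq A B
    have h2 := Submodule.finrank_sup_add_finrank_inf_eq (A ⊔ B) C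
    have h3 : finrank K (A ⊔ B ⊔ C : Submodule K V) ≤ finrank K W :=
      Submodule.finrank_mono (sup_le (sup_le hA hB) hC)
    rw [hAB, finrank_bot] at h1
    obtain ⟨w, hw, hw0⟩ := exists_mem_ne_zero_of_finrank_pos
      (A := (A ⊔ B) ⊓ C) (by omega)
    obtain ⟨u, hu, v, hv, rfl⟩ := Submodule.mem_sup.1 hw.1
    refine ⟨u, hu, v, hv, hw.2, ?_⟩
    by_contra! hcon
    simp [hcon] at hw0
  · obtain ⟨w, hw, hw0⟩ := Submodule.exists_mem_ne_zero_of_ne_bot hAB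
    exact ⟨w, hw.1, -w, B.neg_mem hw.2, by simp, Or.inl hw0⟩

/-- A brick has no nonzero endomorphism of rank two that factors through a plane
spanned by independent `u` and `v`. -/
theorem IsBrick.functionals_eq_zero {p p' q q' s s' : Submodule K V}
    (h : IsBrick p p' q q' s s') (hV : 2 < finrank K V) {f g : V →ₗ[K] K} {u v : V}
    (huv : LinearIndependent K ![u, v])
    (hp : ∀ y ∈ p, f y • u + g y • v ∈ p) (hp' : ∀ y ∈ p', f y • u + g y • v ∈ p')
    (hq : ∀ y ∈ q, f y • u + g y • v ∈ q) (hq' : ∀ y ∈ q', f y • u + g y • v ∈ q')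
    (hs : ∀ y ∈ s, f y • u + g y • v ∈ s) (hs' : ∀ y ∈ s', f y • u + g y • v ∈ s') :
    f = 0 ∧ g = 0 := by
  obtain ⟨c, hc⟩ := h (f.smulRight u + g.smulRight v) hp hp' hq hq' hs hs'
  have h0 := smulRight_add_smulRight_eq_zero_of_eq_smul_id hV f g u v hc
  have key : ∀ y, f y = 0 ∧ g y = 0 := fun y =>
    LinearIndependent.pair_iff.1 huv _ _ (by simpa using LinearMap.congr_fun h0 y)
  exact ⟨LinearMap.ext fun y => (key y).1, LinearMap.ext fun y => (key y).2⟩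

/-- No brick has dimension `kδ + e`, `e` the dimension vector of a line lying in no step of the
first flag, in the large step of the second and in both steps of the third. -/
theorem IsBrick.false_of_type_small_middle_large {p p' q q' s s' : Submodule K V}
    (h : IsBrick p p' q q' s s') (hpp : p ≤ p') (hss : s ≤ s') {k : ℕ}
    (hk : 0 < k) (hV : finrank K V = 3 * k + 1) (hp' : finrank K p' = 2 * k)
    (hq : finrank K q = k) (hq' : finrank K q' = 2 * k + 1) (hs : finrank K s = k + 1) :
    False := by
  have h1 := finrank_add_le_finrank_inf_add q' s
  obtain ⟨w, hw, hw0⟩ := exists_mem_ne_zero_of_finrank_pos (A := q' ⊓ s) (by omega)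
  have h2 := finrank_sup_le_add p' q
  exact hw0 (h.eq_zero (by omega) (p' ⊔ q) (by omega) w (.inr (hpp.trans le_sup_left))
    (.inr le_sup_left) (.inr le_sup_right) (.inl hw.1) (.inl hw.2) (.inl (hss hw.2)))

/-- No brick has dimension `kδ + e`, `e` the dimension vector of a line lying in the large step
of every flag only. -/
theorem IsBrick.false_of_type_middle {p p' q q' s s' : Submodule K V}
    (h : IsBrick p p' q q' s s') {k : ℕ}
    (hk : 0 < k) (hV : finrank K V = 3 * k + 1) (hp : finrank K p = k)
    (hp' : finrank K p' = 2 * k + 1) (hq : finrank K q = k) (hq' : finrank K q' = 2 * k + 1)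
    (hs : finrank K s = k) (hs' : finrank K s' = 2 * k + 1) : False := by
  have h1 := finrank_add_le_finrank_inf_add p' q'
  have h2 := finrank_add_le_finrank_inf_add (p' ⊓ q') s'
  obtain ⟨w, hw, hw0⟩ := exists_mem_ne_zero_of_finrank_pos (A := p' ⊓ q' ⊓ s') (by omega)
  have h3 := finrank_sup_le_add p q
  have h4 := finrank_sup_le_add (p ⊔ q) s
  exact hw0 (h.eq_zero (by omega) (p ⊔ q ⊔ s) (by omega) w
    (.inr (le_sup_left.trans le_sup_left)) (.inl hw.1.1)
    (.inr (le_sup_right.trans le_sup_left)) (.inl hw.1.2) (.inr le_sup_right) (.inl hw.2))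

theorem finrank_dualAnnihilator_add (U : Submodule K V) :
    finrank K U.dualAnnihilator + finrank K U = finrank K V := by
  rw [add_comm]
  exact Subspace.finrank_add_finrank_dualAnnihilator_eq U

/-- No brick has dimension `(k + 1)δ - e`, `e` the dimension vector of a line lying in the large
step of every flag only. -/
theorem IsBrick.false_of_type_comiddle {p p' q q' s s' : Submodule K V}
    (h : IsBrick p p' q q' s s') (hpp : p ≤ p') (hqq : q ≤ q') (hss : s ≤ s') {k : ℕ}
    (hk : 0 < k) (hV : finrank K V = 3 * k + 2) (hp : finrank K p = k + 1)
    (hp' : finrank K p' = 2 * k + 1) (hq : finrank K q = k + 1) (hq' : finrank K q' = 2 * k + 1)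
    (hs : finrank K s = k + 1) (hs' : finrank K s' = 2 * k + 1) : False := by
  obtain ⟨u, hu, v, hv, huv, h0⟩ := exists_add_mem_of_finrank_lt (A := p) (B := q) (C := s)
    (W := ⊤) le_top le_top le_top (by rw [finrank_top]; omega)
  have hli : LinearIndependent K ![u, v] := by
    refine linearIndependent_pair_of_add_mem hu hv huv h0 (fun w h1 h2 => ?_)
      (fun w h1 h2 => ?_) (fun w h1 h2 => ?_)
    · exact h.eq_zero (by omega) s' (by omega) w (.inl h1) (.inl (hpp h1)) (.inl h2)
        (.inl (hqq h2)) (.inr hss) (.inr le_rfl)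
    · exact h.eq_zero (by omega) q' (by omega) w (.inl h1) (.inl (hpp h1)) (.inr hqq)
        (.inr le_rfl) (.inl h2) (.inl (hss h2))
    · exact h.eq_zero (by omega) p' (by omega) w (.inr hpp) (.inr le_rfl) (.inl h1)
        (.inl (hqq h1)) (.inl h2) (.inl (hss h2))
  have d1 := finrank_dualAnnihilator_add p'
  have d2 := finrank_dualAnnihilator_add q'
  have d3 := finrank_dualAnnihilator_add s'
  obtain ⟨f, hf, g, hg, hfg, h1⟩ := exists_add_mem_of_finrank_lt (A := q'.dualAnnihilator)
    (B := p'.dualAnnihilator) (C := s'.dualAnnihilator) (W := ⊤) le_top le_top le_top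
    (by rw [finrank_top, Subspace.dual_finrank_eq]; omega)
  rw [Submodule.mem_dualAnnihilator] at hf hg hfg
  have mem_s : ∀ y ∈ s', f y • u + (-g) y • v ∈ s := fun y hy => by
    have : g y = -f y := eq_neg_of_add_eq_zero_right (by simpa using hfg y hy)
    simpa [this, ← smul_add] using s.smul_mem (f y) huv
  have mem_p : ∀ y ∈ p', f y • u + (-g) y • v ∈ p := fun y hy => by
    simpa [hg y hy] using p.smul_mem (f y) hu
  have mem_q : ∀ y ∈ q', f y • u + (-g) y • v ∈ q := fun y hy => by
    simpa [hf y hy] using q.smul_mem (g y) hv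
  have := h.functionals_eq_zero (by omega) hli (fun y hy => mem_p y (hpp hy))
    (fun y hy => hpp (mem_p y hy)) (fun y hy => mem_q y (hqq hy))
    (fun y hy => hqq (mem_q y hy)) (fun y hy => mem_s y (hss hy)) (fun y hy => hss (mem_s y hy))
  simp [this.1, neg_eq_zero.1 this.2] at h1

/-- No brick has dimension `(k + 1)δ - e`, `e` the dimension vector of a line lying in no step of
one flag, in the large step of another and in both steps of the last. -/
theorem IsBrick.false_of_type_cosmall_comiddle_colarge {p p' q q' s s' : Submodule K V}
    (h : IsBrick p p' q q' s s') (hpp : p ≤ p') (hqq : q ≤ q') (hss : s ≤ s') {k : ℕ}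
    (hk : 0 < k) (hV : finrank K V = 3 * k + 2) (hp : finrank K p = k + 1)
    (hp' : finrank K p' = 2 * k + 2) (hq : finrank K q = k + 1) (hq' : finrank K q' = 2 * k + 1)
    (hs : finrank K s = k) (hs' : finrank K s' = 2 * k + 1) : False := by
  have hpq := finrank_add_le_finrank_inf_add q p'
  obtain ⟨u, hu, v, hv, huv, h0⟩ := exists_add_mem_of_finrank_lt (A := p) (B := q ⊓ p') (C := s')
    (W := ⊤) le_top le_top le_top (by rw [finrank_top]; omega)
  have hqs := finrank_sup_le_add q' s
  have hps := finrank_sup_le_add p s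
  have hli : LinearIndependent K ![u, v] := by
    refine linearIndependent_pair_of_add_mem hu hv huv h0 (fun w h1 h2 => ?_)
      (fun w h1 h2 => ?_) (fun w h1 h2 => ?_)
    · exact h.eq_zero (by omega) s' (by omega) w (.inl h1) (.inl (hpp h1)) (.inl h2.1)
        (.inl (hqq h2.1)) (.inr hss) (.inr le_rfl)
    · exact h.eq_zero (by omega) (q' ⊔ s) (by omega) w (.inl h1) (.inl (hpp h1))
        (.inr (hqq.trans le_sup_left)) (.inr le_sup_left) (.inr le_sup_right) (.inl h2)
    · exact h.eq_zero (by omega) (p ⊔ s) (by omega) w (.inr le_sup_left) (.inl h1.2) (.inl h1.1)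
        (.inl (hqq h1.1)) (.inr le_sup_right) (.inl h2)
  have d1 := finrank_dualAnnihilator_add (q' ⊔ s)
  have d2 := finrank_dualAnnihilator_add (p ⊔ s)
  have d3 := finrank_dualAnnihilator_add s'
  have d4 := finrank_dualAnnihilator_add s
  obtain ⟨f, hf, g, hg, hfg, h1⟩ := exists_add_mem_of_finrank_lt
    (A := (q' ⊔ s).dualAnnihilator) (B := (p ⊔ s).dualAnnihilator) (C := s'.dualAnnihilator)
    (W := s.dualAnnihilator) (Submodule.dualAnnihilator_anti le_sup_right)
    (Submodule.dualAnnihilator_anti le_sup_right) (Submodule.dualAnnihilator_anti hss)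
    (by omega)
  rw [Submodule.mem_dualAnnihilator] at hf hg hfg
  have hfq : ∀ y ∈ q', f y = 0 := fun y hy => hf y (Submodule.mem_sup_left hy)
  have hfs : ∀ y ∈ s, f y = 0 := fun y hy => hf y (Submodule.mem_sup_right hy)
  have hgp : ∀ y ∈ p, g y = 0 := fun y hy => hg y (Submodule.mem_sup_left hy)
  have hgs : ∀ y ∈ s, g y = 0 := fun y hy => hg y (Submodule.mem_sup_right hy)
  have mem_q : ∀ y ∈ q', f y • u + (-g) y • v ∈ q := fun y hy => by
    simpa [hfq y hy] using q.smul_mem (g y) hv.1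
  have := h.functionals_eq_zero (by omega) hli
    (fun y hy => by simpa [hgp y hy] using p.smul_mem (f y) hu)
    (fun y hy => p'.add_mem (p'.smul_mem _ (hpp hu)) (p'.smul_mem _ hv.2))
    (fun y hy => mem_q y (hqq hy)) (fun y hy => hqq (mem_q y hy))
    (fun y hy => by simp [hfs y hy, hgs y hy])
    (fun y hy => by
      have : g y = -f y := eq_neg_of_add_eq_zero_right (by simpa using hfg y hy)
      simpa [this, ← smul_add] using s'.smul_mem (f y) huv)
  simp [this.1, neg_eq_zero.1 this.2] at h1

/-- The Tits form of the dimension vector of a brick is at most one, the small and large step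
of each flag being `p` and `p ⊔ c`. -/
theorem IsBrick.finrank_sq_le {p c q d s e : Submodule K V}
    (h : IsBrick p (p ⊔ c) q (q ⊔ d) s (s ⊔ e)) :
    finrank K V * finrank K V ≤ 1 +
      (finrank K p * finrank K (V ⧸ p) + finrank K c * finrank K (V ⧸ (p ⊔ c)) +
      (finrank K q * finrank K (V ⧸ q) + finrank K d * finrank K (V ⧸ (q ⊔ d))) +
      (finrank K s * finrank K (V ⧸ s) + finrank K e * finrank K (V ⧸ (s ⊔ e)))) := by
  let r (A B : Submodule K V) : (V →ₗ[K] V) →ₗ[K] (A →ₗ[K] V ⧸ B) :=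
    LinearMap.lcomp K (V ⧸ B) A.subtype ∘ₗ LinearMap.compRight K B.mkQ
  have hr : ∀ (A B : Submodule K V) X, r A B X = 0 → A ≤ B.comap X := fun A B X hX y hy => by
    simpa [r] using LinearMap.congr_fun hX ⟨y, hy⟩
  have hsup : ∀ (A B : Submodule K V) X, r A A X = 0 → r B (A ⊔ B) X = 0 →
      A ⊔ B ≤ (A ⊔ B).comap X := fun A B X h1 h2 =>
    sup_le ((hr _ _ _ h1).trans (Submodule.comap_mono le_sup_left)) (hr _ _ _ h2)
  let Φ := (((r p p).prod (r c (p ⊔ c))).prod ((r q q).prod (r d (q ⊔ d)))).prod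
    ((r s s).prod (r e (s ⊔ e)))
  have hker : LinearMap.ker Φ ≤ K ∙ (LinearMap.id : V →ₗ[K] V) := by
    intro X hX
    simp only [Φ, LinearMap.ker_prod, Submodule.mem_inf, LinearMap.mem_ker] at hX
    obtain ⟨⟨⟨h1, h2⟩, h3, h4⟩, h5, h6⟩ := hX
    obtain ⟨a, rfl⟩ := h X (hr _ _ _ h1) (hsup _ _ _ h1 h2) (hr _ _ _ h3) (hsup _ _ _ h3 h4)
      (hr _ _ _ h5) (hsup _ _ _ h5 h6)
    exact Submodule.mem_span_singleton.2 ⟨a, rfl⟩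
  have h1 := Φ.finrank_range_add_finrank_ker
  have h2 : finrank K (LinearMap.ker Φ) ≤ 1 := (Submodule.finrank_mono hker).trans
    ((finrank_span_le_card {LinearMap.id}).trans_eq (by simp))
  have h3 := Submodule.finrank_le (LinearMap.range Φ)
  simp only [Module.finrank_prod, Module.finrank_linearMap] at h1 h3
  omega

end Bricks

section Projections

open Module ComplexOrder

variable {m : ℕ}

theorem IsProjection.mulVec_of_mem_range {P : Matrix (Fin m) (Fin m) ℂ} (hP : IsProjection P)
    {y : Fin m → ℂ} (hy : y ∈ LinearMap.range P.mulVecLin) : P *ᵥ y = y := by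
  obtain ⟨z, rfl⟩ := hy
  simp [hP.2]

theorem IsProjection.mul_mul_eq_of_le_comap {P X : Matrix (Fin m) (Fin m) ℂ}
    (hP : IsProjection P)
    (h : LinearMap.range P.mulVecLin ≤ (LinearMap.range P.mulVecLin).comap X.mulVecLin) :
    P * X * P = X * P := by
  refine Matrix.ext_of_mulVec_single fun i => ?_
  have := hP.mulVec_of_mem_range (h (LinearMap.mem_range_self P.mulVecLin (Pi.single i 1)))
  simpa only [Matrix.mulVecLin_apply, Matrix.mulVec_mulVec, Matrix.mul_assoc] using this

theorem IsProjection.trace_commutator {P X : Matrix (Fin m) (Fin m) ℂ} (hP : IsProjection P)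
    (hX : P * X * P = X * P) :
    ((P * X - X * P) * (P * X - X * P)ᴴ).trace =
      (P * (X * Xᴴ)).trace - (P * (Xᴴ * X)).trace := by
  have hPh : Pᴴ = P := hP.1
  have e1 : (P * X * (Xᴴ * P)).trace = (P * (X * Xᴴ)).trace := by
    rw [← Matrix.mul_assoc, Matrix.trace_mul_comm]
    simp only [← Matrix.mul_assoc, hP.2]
  have e2 : (X * P * (P * Xᴴ)).trace = (P * (Xᴴ * X)).trace := by
    rw [Matrix.mul_assoc, ← Matrix.mul_assoc P P, hP.2, Matrix.trace_mul_comm X, Matrix.mul_assoc]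
  have e3 : (P * X * (P * Xᴴ)).trace = (P * (Xᴴ * X)).trace := by
    rw [← Matrix.mul_assoc, hX, Matrix.mul_assoc, Matrix.trace_mul_comm X, Matrix.mul_assoc]
  have e4 : (X * P * (Xᴴ * P)).trace = (P * (Xᴴ * X)).trace := by
    rw [← Matrix.mul_assoc, Matrix.trace_mul_comm, ← Matrix.mul_assoc, ← Matrix.mul_assoc, hX,
      Matrix.mul_assoc, Matrix.trace_mul_comm X, Matrix.mul_assoc]
  simp only [Matrix.conjTranspose_sub, Matrix.conjTranspose_mul, hPh, Matrix.sub_mul,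
    Matrix.mul_sub, Matrix.trace_sub, e1, e2, e3, e4]
  ring

/-- A matrix preserving the ranges of projections whose positive combination is a scalar
commutes with each of them. -/
theorem commute_of_forall_mul_mul_eq {ι : Type*} [Fintype ι] {w : ι → ℝ} (hw : ∀ i, 0 < w i)
    {P : ι → Matrix (Fin m) (Fin m) ℂ} (hP : ∀ i, IsProjection (P i)) {γ : ℝ}
    (hsum : ∑ i, (w i : ℂ) • P i = (γ : ℂ) • (1 : Matrix (Fin m) (Fin m) ℂ))
    {X : Matrix (Fin m) (Fin m) ℂ} (hX : ∀ i, P i * X * P i = X * P i) (i : ι) :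
    X * P i = P i * X := by
  set Y : ι → Matrix (Fin m) (Fin m) ℂ := fun i => P i * X - X * P i with hY
  have expand : ∀ Z : Matrix (Fin m) (Fin m) ℂ,
      ∑ i, (w i : ℂ) * (P i * Z).trace = γ * Z.trace := fun Z => by
    have := congrArg (fun A => (A * Z).trace) hsum
    simpa [Matrix.sum_mul, Matrix.trace_sum] using this
  have hzero : ∑ i, (w i : ℂ) * (Y i * (Y i)ᴴ).trace = 0 := by
    simp only [hY, fun i => (hP i).trace_commutator (hX i), mul_sub, Finset.sum_sub_distrib,
      expand]
    rw [Matrix.trace_mul_comm, sub_self]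
  have hnonneg : ∀ i ∈ Finset.univ, 0 ≤ (w i : ℂ) * (Y i * (Y i)ᴴ).trace := fun i _ =>
    mul_nonneg (by exact_mod_cast (hw i).le)
      (Matrix.posSemidef_self_mul_conjTranspose (Y i)).trace_nonneg
  have h0 := (Finset.sum_eq_zero_iff_of_nonneg hnonneg).1 hzero i (Finset.mem_univ i)
  have hwi : (w i : ℂ) ≠ 0 := by exact_mod_cast (hw i).ne'
  have hYi : Y i = 0 :=
    Matrix.trace_mul_conjTranspose_self_eq_zero_iff.1 ((mul_eq_zero.1 h0).resolve_left hwi)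
  exact (sub_eq_zero.1 hYi).symm

theorem IsProjection.mul_eq_zero_symm {P Q : Matrix (Fin m) (Fin m) ℂ} (hP : IsProjection P)
    (hQ : IsProjection Q) (h : P * Q = 0) : Q * P = 0 := by
  have hPh : Pᴴ = P := hP.1
  have hQh : Qᴴ = Q := hQ.1
  simpa [hPh, hQh] using congrArg Matrix.conjTranspose h

theorem IsProjection.add {P Q : Matrix (Fin m) (Fin m) ℂ} (hP : IsProjection P)
    (hQ : IsProjection Q) (h : P * Q = 0) : IsProjection (P + Q) :=
  ⟨hP.1.add hQ.1, by
    rw [Matrix.add_mul, Matrix.mul_add, Matrix.mul_add, h, hP.mul_eq_zero_symm hQ h, hP.2, hQ.2,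
      add_zero, zero_add]⟩

theorem IsProjection.range_add {P Q : Matrix (Fin m) (Fin m) ℂ} (hP : IsProjection P)
    (hQ : IsProjection Q) (h : P * Q = 0) :
    LinearMap.range (P + Q).mulVecLin =
      LinearMap.range P.mulVecLin ⊔ LinearMap.range Q.mulVecLin := by
  have h' := hP.mul_eq_zero_symm hQ h
  apply le_antisymm
  · rintro _ ⟨z, rfl⟩
    rw [Matrix.mulVecLin_add, LinearMap.add_apply]
    exact Submodule.add_mem_sup (LinearMap.mem_range_self _ z) (LinearMap.mem_range_self _ z)
  · refine sup_le ?_ ?_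
    · rintro _ ⟨z, rfl⟩
      exact ⟨P *ᵥ z, by simp [hP.2, h']⟩
    · rintro _ ⟨z, rfl⟩
      exact ⟨Q *ᵥ z, by simp [hQ.2, h]⟩

theorem IsProjection.trace_eq_rank {P : Matrix (Fin m) (Fin m) ℂ} (hP : IsProjection P) :
    P.trace = P.rank := by
  have h : LinearMap.IsProj (LinearMap.range P.mulVecLin) P.mulVecLin :=
    ⟨fun y => LinearMap.mem_range_self _ y, fun y hy => hP.mulVec_of_mem_range hy⟩
  rw [Matrix.rank, ← h.trace, ← Matrix.toLin'_apply', Matrix.trace_toLin'_eq]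

theorem IsProjection.rank_add {P Q : Matrix (Fin m) (Fin m) ℂ} (hP : IsProjection P)
    (hQ : IsProjection Q) (h : P * Q = 0) : (P + Q).rank = P.rank + Q.rank := by
  have := (hP.add hQ h).trace_eq_rank
  rw [Matrix.trace_add, hP.trace_eq_rank, hQ.trace_eq_rank] at this
  exact_mod_cast this.symm

theorem IsProjection.rank_lt {P : Matrix (Fin m) (Fin m) ℂ} (hP : IsProjection P) (h : P ≠ 1) :
    P.rank < m := by
  refine lt_of_le_of_ne (by simpa using P.rank_le_width) fun hm => h ?_
  have htop : LinearMap.range P.mulVecLin = ⊤ :=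
    Submodule.eq_top_of_finrank_eq (by simpa [Matrix.rank] using hm)
  refine Matrix.ext_of_mulVec_single fun i => ?_
  rw [hP.mulVec_of_mem_range (by rw [htop]; trivial), Matrix.one_mulVec]

/-- The flags `im P₁ ⊆ im P₁ ⊕ im P₂` of an irreducible representation form a brick. -/
theorem isBrick_of_isIrredRep {α1 α2 β1 β2 δ1 δ2 γ : ℝ}
    (hα1 : α2 < α1) (hα2 : 0 < α2) (hβ1 : β2 < β1) (hβ2 : 0 < β2)
    (hδ1 : δ2 < δ1) (hδ2 : 0 < δ2) {n : Fin 7 → ℕ}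
    {P1 P2 Q1 Q2 S1 S2 : Matrix (Fin (n 6)) (Fin (n 6)) ℂ}
    (hrep : IsRepE6 α1 α2 β1 β2 δ1 δ2 γ n P1 P2 Q1 Q2 S1 S2)
    (hirr : IsIrredRep P1 P2 Q1 Q2 S1 S2) :
    IsBrick (LinearMap.range P1.mulVecLin)
      (LinearMap.range P1.mulVecLin ⊔ LinearMap.range P2.mulVecLin)
      (LinearMap.range Q1.mulVecLin)
      (LinearMap.range Q1.mulVecLin ⊔ LinearMap.range Q2.mulVecLin)
      (LinearMap.range S1.mulVecLin)
      (LinearMap.range S1.mulVecLin ⊔ LinearMap.range S2.mulVecLin) := by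
  obtain ⟨hP1, hP2, hQ1, hQ2, hS1, hS2, hP, hQ, hS, -, -, -, -, -, -, hsum⟩ := hrep
  intro X h1 h2 h3 h4 h5 h6
  rw [← hP1.range_add hP2 hP] at h2
  rw [← hQ1.range_add hQ2 hQ] at h4
  rw [← hS1.range_add hS2 hS] at h6
  obtain ⟨A, rfl⟩ : ∃ A : Matrix (Fin (n 6)) (Fin (n 6)) ℂ, X = A.mulVecLin :=
    ⟨LinearMap.toMatrix' X, (Matrix.toLin'_toMatrix' X).symm⟩
  have hcomm := commute_of_forall_mul_mul_eq
    (w := ![α1 - α2, α2, β1 - β2, β2, δ1 - δ2, δ2])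
    (by intro i; fin_cases i <;> simp <;> linarith)
    (P := ![P1, P1 + P2, Q1, Q1 + Q2, S1, S1 + S2])
    (by intro i; fin_cases i
        exacts [hP1, hP1.add hP2 hP, hQ1, hQ1.add hQ2 hQ, hS1, hS1.add hS2 hS])
    (γ := γ)
    (by rw [← hsum]
        simp [Fin.sum_univ_six]
        module)
    (X := A)
    (by intro i; fin_cases i
        exacts [hP1.mul_mul_eq_of_le_comap h1, (hP1.add hP2 hP).mul_mul_eq_of_le_comap h2,
          hQ1.mul_mul_eq_of_le_comap h3, (hQ1.add hQ2 hQ).mul_mul_eq_of_le_comap h4,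
          hS1.mul_mul_eq_of_le_comap h5, (hS1.add hS2 hS).mul_mul_eq_of_le_comap h6])
  have cP1 : A * P1 = P1 * A := hcomm 0
  have cP : A * (P1 + P2) = (P1 + P2) * A := hcomm 1
  have cQ1 : A * Q1 = Q1 * A := hcomm 2
  have cQ : A * (Q1 + Q2) = (Q1 + Q2) * A := hcomm 3
  have cS1 : A * S1 = S1 * A := hcomm 4
  have cS : A * (S1 + S2) = (S1 + S2) * A := hcomm 5
  rw [Matrix.mul_add, Matrix.add_mul, cP1] at cP
  rw [Matrix.mul_add, Matrix.add_mul, cQ1] at cQ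
  rw [Matrix.mul_add, Matrix.add_mul, cS1] at cS
  obtain ⟨c, rfl⟩ := hirr A cP1 (add_left_cancel cP) cQ1 (add_left_cancel cQ) cS1
    (add_left_cancel cS)
  exact ⟨c, by ext; simp⟩

/-- The trace of the defining relation of a representation. -/
theorem IsRepE6.trace_relation {α1 α2 β1 β2 δ1 δ2 γ : ℝ} {n : Fin 7 → ℕ}
    {P1 P2 Q1 Q2 S1 S2 : Matrix (Fin (n 6)) (Fin (n 6)) ℂ}
    (hrep : IsRepE6 α1 α2 β1 β2 δ1 δ2 γ n P1 P2 Q1 Q2 S1 S2) :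
    α1 * n 0 + α2 * n 1 + β1 * n 2 + β2 * n 3 + δ1 * n 4 + δ2 * n 5 = γ * n 6 := by
  obtain ⟨hP1, hP2, hQ1, hQ2, hS1, hS2, -, -, -, r1, r2, r3, r4, r5, r6, hsum⟩ := hrep
  have := congrArg Matrix.trace hsum
  simp only [Matrix.trace_add, Matrix.trace_smul, hP1.trace_eq_rank, hP2.trace_eq_rank,
    hQ1.trace_eq_rank, hQ2.trace_eq_rank, hS1.trace_eq_rank, hS2.trace_eq_rank, r1, r2, r3, r4,
    r5, r6, Matrix.trace_one, Fintype.card_fin, smul_eq_mul] at this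
  exact_mod_cast this

end Projections

section Dimensions

/-- Membership of a generalized dimension in one of the three families. -/
def IsListed (n : Fin 7 → ℕ) : Prop :=
  (∃ k : ℕ, 15 ≤ k ∧ ∀ i, (n i : ℤ) = (MdZ *ᵥ dFamI k) i) ∨
  (∃ k : ℕ, 8 ≤ k ∧ ∀ i, (n i : ℤ) = (MdZ *ᵥ dFamII k) i) ∨
  (∃ k : ℕ, 5 ≤ k ∧ ∀ i, (n i : ℤ) = (MdZ *ᵥ dFamIII k) i)

theorem exists_isListed_permDim_of_first {n : Fin 7 → ℕ}
    (h : IsListed ![n 0, n 1, n 2, n 3, n 4, n 5, n 6]) : ∃ σ, IsListed (permDim σ n) :=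
  ⟨1, h⟩

theorem exists_isListed_permDim_of_second {n : Fin 7 → ℕ}
    (h : IsListed ![n 2, n 3, n 0, n 1, n 4, n 5, n 6]) : ∃ σ, IsListed (permDim σ n) :=
  ⟨Equiv.swap 0 1, h⟩

theorem exists_isListed_permDim_of_third {n : Fin 7 → ℕ}
    (h : IsListed ![n 4, n 5, n 2, n 3, n 0, n 1, n 6]) : ∃ σ, IsListed (permDim σ n) :=
  ⟨Equiv.swap 0 2, h⟩

theorem MdZ_mulVec (x : Fin 7 → ℤ) :
    MdZ *ᵥ x = ![x 1 - x 0, x 0, x 3 - x 2, x 2, x 5 - x 4, x 4, x 6] := by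
  ext i
  fin_cases i <;> simp [MdZ, Matrix.mulVec, dotProduct, Fin.sum_univ_succ] <;> ring

theorem eq_MdZ_mulVec_add_smul {n : Fin 7 → ℕ} {v : Fin 7 → ℤ} {q : ℕ}
    (h0 : (n 0 : ℤ) = v 1 - v 0 + q) (h1 : (n 1 : ℤ) = v 0 + q)
    (h2 : (n 2 : ℤ) = v 3 - v 2 + q) (h3 : (n 3 : ℤ) = v 2 + q)
    (h4 : (n 4 : ℤ) = v 5 - v 4 + q) (h5 : (n 5 : ℤ) = v 4 + q)
    (h6 : (n 6 : ℤ) = v 6 + 3 * q) (i : Fin 7) :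
    (n i : ℤ) = (MdZ *ᵥ (v + (q : ℤ) • deltaZ)) i := by
  rw [MdZ_mulVec]
  fin_cases i <;> simp [deltaZ, *] <;> ring

theorem isListed_of_famI {a1 a2 b1 b2 N : ℕ} (r : Fin 12) (q : ℕ) (hk : 14 ≤ 12 * q + r)
    (h : (a1 : ℤ) = vFamI r 1 - vFamI r 0 + q ∧ (a2 : ℤ) = vFamI r 0 + q ∧
      (b1 : ℤ) = vFamI r 3 - vFamI r 2 + q ∧ (b2 : ℤ) = vFamI r 2 + q ∧
      (b1 : ℤ) = vFamI r 5 - vFamI r 4 + q ∧ (b2 : ℤ) = vFamI r 4 + q ∧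
      (N : ℤ) = vFamI r 6 + 3 * q) :
    IsListed ![a1, a2, b1, b2, b1, b2, N] := by
  refine Or.inl ⟨12 * q + r + 1, by omega, ?_⟩
  have h1 : (12 * q + (r : ℕ) + 1 - 1) % 12 = r := by omega
  have h2 : (12 * q + (r : ℕ) + 1 - 1) / 12 = q := by omega
  simp only [dFamI, h1, h2]
  exact eq_MdZ_mulVec_add_smul h.1 h.2.1 h.2.2.1 h.2.2.2.1 h.2.2.2.2.1 h.2.2.2.2.2.1 h.2.2.2.2.2.2

theorem isListed_of_famII {a1 a2 b1 b2 N : ℕ} (r : Fin 6) (q : ℕ) (hk : 7 ≤ 6 * q + r)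
    (h : (a1 : ℤ) = vFamII r 1 - vFamII r 0 + q ∧ (a2 : ℤ) = vFamII r 0 + q ∧
      (b1 : ℤ) = vFamII r 3 - vFamII r 2 + q ∧ (b2 : ℤ) = vFamII r 2 + q ∧
      (b1 : ℤ) = vFamII r 5 - vFamII r 4 + q ∧ (b2 : ℤ) = vFamII r 4 + q ∧
      (N : ℤ) = vFamII r 6 + 3 * q) :
    IsListed ![a1, a2, b1, b2, b1, b2, N] := by
  refine Or.inr (Or.inl ⟨6 * q + r + 1, by omega, ?_⟩)
  have h1 : (6 * q + (r : ℕ) + 1 - 1) % 6 = r := by omega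
  have h2 : (6 * q + (r : ℕ) + 1 - 1) / 6 = q := by omega
  simp only [dFamII, h1, h2]
  exact eq_MdZ_mulVec_add_smul h.1 h.2.1 h.2.2.1 h.2.2.2.1 h.2.2.2.2.1 h.2.2.2.2.2.1 h.2.2.2.2.2.2

theorem isListed_of_famIII {a1 a2 b1 b2 N : ℕ} (r : Fin 4) (q : ℕ) (hk : 4 ≤ 4 * q + r)
    (h : (a1 : ℤ) = vFamIII r 1 - vFamIII r 0 + q ∧ (a2 : ℤ) = vFamIII r 0 + q ∧
      (b1 : ℤ) = vFamIII r 3 - vFamIII r 2 + q ∧ (b2 : ℤ) = vFamIII r 2 + q ∧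
      (b1 : ℤ) = vFamIII r 5 - vFamIII r 4 + q ∧ (b2 : ℤ) = vFamIII r 4 + q ∧
      (N : ℤ) = vFamIII r 6 + 3 * q) :
    IsListed ![a1, a2, b1, b2, b1, b2, N] := by
  refine Or.inr (Or.inr ⟨4 * q + r + 1, by omega, ?_⟩)
  have h1 : (4 * q + (r : ℕ) + 1 - 1) % 4 = r := by omega
  have h2 : (4 * q + (r : ℕ) + 1 - 1) / 4 = q := by omega
  simp only [dFamIII, h1, h2]
  exact eq_MdZ_mulVec_add_smul h.1 h.2.1 h.2.2.1 h.2.2.2.1 h.2.2.2.2.1 h.2.2.2.2.2.1 h.2.2.2.2.2.2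

/-- The possible shapes of a branch when the central dimension is `3t`. -/
def ShapeZero (t a1 a2 : ℕ) : Prop :=
  (a1 + 1 = t ∧ a2 = t + 1) ∨ (a1 = t ∧ a2 = t + 1) ∨ (a1 = t + 1 ∧ a2 = t) ∨
    (a1 + 1 = t ∧ a2 = t) ∨ (a1 = t ∧ a2 + 1 = t) ∨ (a1 = t + 1 ∧ a2 + 1 = t)

/-- The possible shapes of a branch when the central dimension is `3t + 1`. -/
def ShapeOne (t a1 a2 : ℕ) : Prop :=
  (a1 = t ∧ a2 = t) ∨ (a1 = t ∧ a2 = t + 1) ∨ (a1 = t + 1 ∧ a2 = t)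

/-- The possible shapes of a branch when the central dimension is `3t + 2`. -/
def ShapeTwo (t a1 a2 : ℕ) : Prop :=
  (a1 = t ∧ a2 = t + 1) ∨ (a1 = t + 1 ∧ a2 = t) ∨ (a1 = t + 1 ∧ a2 = t + 1)

theorem isListed_of_shapeZero {t a1 a2 N : ℕ} (h : ShapeZero t a1 a2)
    (h1 : 0 < a1) (h2 : 0 < a2) (hN : a1 + a2 < N) (hNt : N = 3 * t) :
    IsListed ![a1, a2, t, t, t, t, N] := by
  rcases h with h | h | h | h | h | h
  · exact isListed_of_famI 0 t (by simp; omega) (by simp [vFamI]; omega)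
  · exact isListed_of_famI 1 t (by simp; omega) (by simp [vFamI]; omega)
  · exact isListed_of_famII 0 t (by simp; omega) (by simp [vFamII]; omega)
  · exact isListed_of_famII 5 (t - 1) (by simp; omega) (by simp [vFamII]; omega)
  · exact isListed_of_famI 10 (t - 1) (by simp; omega) (by simp [vFamI]; omega)
  · exact isListed_of_famI 11 (t - 1) (by simp; omega) (by simp [vFamI]; omega)

theorem isListed_of_shapeOne {t a1 a2 b1 b2 N : ℕ} (ha : ShapeOne t a1 a2)
    (hb : ShapeOne t b1 b2) (ht : 0 < t) (hN : N = 3 * t + 1)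
    (hne : ¬(a1 = t ∧ a2 = t + 1 ∧ b1 = t ∧ b2 = t + 1)) :
    IsListed ![a1, a2, b1, b2, b1, b2, N] := by
  rcases ha with h | h | h <;> rcases hb with h' | h' | h'
  · exact isListed_of_famIII 0 t (by simp; omega) (by simp [vFamIII]; omega)
  · exact isListed_of_famI 4 t (by simp; omega) (by simp [vFamI]; omega)
  · exact isListed_of_famI 3 t (by simp; omega) (by simp [vFamI]; omega)
  · exact isListed_of_famII 1 t (by simp; omega) (by simp [vFamII]; omega)
  · omega
  · exact isListed_of_famII 2 t (by simp; omega) (by simp [vFamII]; omega)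
  · exact isListed_of_famI 2 t (by simp; omega) (by simp [vFamI]; omega)
  · exact isListed_of_famI 5 t (by simp; omega) (by simp [vFamI]; omega)
  · exact isListed_of_famIII 1 t (by simp; omega) (by simp [vFamIII]; omega)

theorem isListed_of_shapeTwo {t a1 a2 b1 b2 N : ℕ} (ha : ShapeTwo t a1 a2)
    (hb : ShapeTwo t b1 b2) (ht : 0 < t) (hN : N = 3 * t + 2)
    (hne : ¬(a1 = t + 1 ∧ a2 = t ∧ b1 = t + 1 ∧ b2 = t)) :
    IsListed ![a1, a2, b1, b2, b1, b2, N] := by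
  rcases ha with h | h | h <;> rcases hb with h' | h' | h'
  · exact isListed_of_famIII 2 t (by simp; omega) (by simp [vFamIII]; omega)
  · exact isListed_of_famI 6 t (by simp; omega) (by simp [vFamI]; omega)
  · exact isListed_of_famI 9 t (by simp; omega) (by simp [vFamI]; omega)
  · exact isListed_of_famII 3 t (by simp; omega) (by simp [vFamII]; omega)
  · omega
  · exact isListed_of_famII 4 t (by simp; omega) (by simp [vFamII]; omega)
  · exact isListed_of_famI 8 t (by simp; omega) (by simp [vFamI]; omega)
  · exact isListed_of_famI 7 t (by simp; omega) (by simp [vFamI]; omega)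
  · exact isListed_of_famIII 3 t (by simp; omega) (by simp [vFamIII]; omega)

/-- The contribution of a branch to three times the Tits form. -/
def branchForm (N a1 a2 : ℤ) : ℤ := N * N - 3 * (a1 * (N - a1) + a2 * (N - (a1 + a2)))

theorem branchForm_nonneg (N a1 a2 : ℤ) : 0 ≤ branchForm N a1 a2 := by
  unfold branchForm
  nlinarith [sq_nonneg (3 * a1 - N), sq_nonneg (a1 + 2 * a2 - N)]

theorem branchForm_three_mul {t a1 a2 : ℕ} (h : branchForm (3 * t) a1 a2 ≤ 3) :
    (branchForm (3 * t) a1 a2 = 0 ∧ a1 = t ∧ a2 = t) ∨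
      (branchForm (3 * t) a1 a2 = 3 ∧ ShapeZero t a1 a2) := by
  obtain ⟨i, hi⟩ : ∃ i : ℤ, (a1 : ℤ) = t + i := ⟨a1 - t, by ring⟩
  obtain ⟨j, hj⟩ : ∃ j : ℤ, (a2 : ℤ) = t + j := ⟨a2 - t, by ring⟩
  have hF : branchForm (3 * t) a1 a2 = 3 * (i * i + i * j + j * j) := by
    rw [branchForm, hi, hj]; ring
  have hi1 : -1 ≤ i := by nlinarith [sq_nonneg (2 * j + i)]
  have hi2 : i ≤ 1 := by nlinarith [sq_nonneg (2 * j + i)]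
  have hj1 : -1 ≤ j := by nlinarith [sq_nonneg (2 * i + j)]
  have hj2 : j ≤ 1 := by nlinarith [sq_nonneg (2 * i + j)]
  rw [hF] at h ⊢
  unfold ShapeZero
  interval_cases i <;> interval_cases j <;> omega

theorem branchForm_three_mul_add_one (t a1 a2 : ℕ) :
    1 ≤ branchForm (3 * t + 1) a1 a2 ∧
      (branchForm (3 * t + 1) a1 a2 ≤ 1 → ShapeOne t a1 a2) := by
  obtain ⟨i, hi⟩ : ∃ i : ℤ, (a1 : ℤ) = t + i := ⟨a1 - t, by ring⟩
  obtain ⟨j, hj⟩ : ∃ j : ℤ, (a2 : ℤ) = t + j := ⟨a2 - t, by ring⟩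
  have hF : branchForm (3 * t + 1) a1 a2 = 1 + 3 * (i * i + i * j + j * j - i - j) := by
    rw [branchForm, hi, hj]; ring
  have hnn := branchForm_nonneg (3 * t + 1) a1 a2
  refine ⟨by omega, fun h => ?_⟩
  have hi1 : 0 ≤ i := by nlinarith [sq_nonneg (2 * j + i - 1)]
  have hi2 : i ≤ 1 := by nlinarith [sq_nonneg (2 * j + i - 1)]
  have hj1 : 0 ≤ j := by nlinarith [sq_nonneg (2 * i + j - 1)]
  have hj2 : j ≤ 1 := by nlinarith [sq_nonneg (2 * i + j - 1)]
  rw [hF] at h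
  unfold ShapeOne
  interval_cases i <;> interval_cases j <;> omega

theorem branchForm_three_mul_add_two (t a1 a2 : ℕ) :
    1 ≤ branchForm (3 * t + 2) a1 a2 ∧
      (branchForm (3 * t + 2) a1 a2 ≤ 1 → ShapeTwo t a1 a2) := by
  obtain ⟨i, hi⟩ : ∃ i : ℤ, (a1 : ℤ) = t + i := ⟨a1 - t, by ring⟩
  obtain ⟨j, hj⟩ : ∃ j : ℤ, (a2 : ℤ) = t + j := ⟨a2 - t, by ring⟩
  have hF : branchForm (3 * t + 2) a1 a2 = 1 + 3 * (i * i + i * j + j * j - 2 * i - 2 * j + 1) := by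
    rw [branchForm, hi, hj]; ring
  have hnn := branchForm_nonneg (3 * t + 2) a1 a2
  refine ⟨by omega, fun h => ?_⟩
  have hi1 : 0 ≤ i := by nlinarith [sq_nonneg (2 * j + i - 2)]
  have hi2 : i ≤ 1 := by nlinarith [sq_nonneg (2 * j + i - 2)]
  have hj1 : 0 ≤ j := by nlinarith [sq_nonneg (2 * i + j - 2)]
  have hj2 : j ≤ 1 := by nlinarith [sq_nonneg (2 * i + j - 2)]
  rw [hF] at h
  unfold ShapeTwo
  interval_cases i <;> interval_cases j <;> omega

end Dimensions

section Exclusion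

open Module

variable {K V : Type*} [Field K] [AddCommGroup V] [Module K V] [FiniteDimensional K V]

theorem IsBrick.two_shapes_eq_of_shapeOne {p p' q q' s s' : Submodule K V}
    (h : IsBrick p p' q q' s s') (hpp : p ≤ p') (hqq : q ≤ q') (hss : s ≤ s')
    {t a1 a2 b1 b2 c1 c2 : ℕ} (ht : 0 < t) (hV : finrank K V = 3 * t + 1)
    (hp : finrank K p = a1) (hp' : finrank K p' = a1 + a2)
    (hq : finrank K q = b1) (hq' : finrank K q' = b1 + b2)
    (hs : finrank K s = c1) (hs' : finrank K s' = c1 + c2)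
    (ha : ShapeOne t a1 a2) (hb : ShapeOne t b1 b2) (hc : ShapeOne t c1 c2) :
    ¬(a1 = t ∧ a2 = t + 1 ∧ b1 = t ∧ b2 = t + 1 ∧ c1 = t ∧ c2 = t + 1) ∧
      ((b1 = c1 ∧ b2 = c2) ∨ (a1 = c1 ∧ a2 = c2) ∨ (a1 = b1 ∧ a2 = b2)) := by
  refine ⟨fun ⟨e1, e2, e3, e4, e5, e6⟩ => h.false_of_type_middle ht hV (by omega) (by omega)
    (by omega) (by omega) (by omega) (by omega), ?_⟩
  by_contra hne
  rcases ha with ha | ha | ha <;> rcases hb with hb | hb | hb <;> rcases hc with hc | hc | hc <;>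
    first
    | omega
    | exact h.false_of_type_small_middle_large hpp hss ht hV (by omega) (by omega) (by omega)
        (by omega)
    | exact h.swap₁₂.false_of_type_small_middle_large hqq hss ht hV (by omega) (by omega)
        (by omega) (by omega)
    | exact h.swap₂₃.false_of_type_small_middle_large hpp hqq ht hV (by omega) (by omega)
        (by omega) (by omega)
    | exact h.swap₁₂.swap₂₃.false_of_type_small_middle_large hqq hpp ht hV (by omega) (by omega)
        (by omega) (by omega)
    | exact h.swap₂₃.swap₁₂.false_of_type_small_middle_large hss hqq ht hV (by omega) (by omega)
        (by omega) (by omega)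
    | exact h.swap₁₂.swap₂₃.swap₁₂.false_of_type_small_middle_large hss hpp ht hV (by omega)
        (by omega) (by omega) (by omega)

theorem IsBrick.two_shapes_eq_of_shapeTwo {p p' q q' s s' : Submodule K V}
    (h : IsBrick p p' q q' s s') (hpp : p ≤ p') (hqq : q ≤ q') (hss : s ≤ s')
    {t a1 a2 b1 b2 c1 c2 : ℕ} (ht : 0 < t) (hV : finrank K V = 3 * t + 2)
    (hp : finrank K p = a1) (hp' : finrank K p' = a1 + a2)
    (hq : finrank K q = b1) (hq' : finrank K q' = b1 + b2)
    (hs : finrank K s = c1) (hs' : finrank K s' = c1 + c2)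
    (ha : ShapeTwo t a1 a2) (hb : ShapeTwo t b1 b2) (hc : ShapeTwo t c1 c2) :
    ¬(a1 = t + 1 ∧ a2 = t ∧ b1 = t + 1 ∧ b2 = t ∧ c1 = t + 1 ∧ c2 = t) ∧
      ((b1 = c1 ∧ b2 = c2) ∨ (a1 = c1 ∧ a2 = c2) ∨ (a1 = b1 ∧ a2 = b2)) := by
  refine ⟨fun ⟨e1, e2, e3, e4, e5, e6⟩ => h.false_of_type_comiddle hpp hqq hss ht hV (by omega)
    (by omega) (by omega) (by omega) (by omega) (by omega), ?_⟩
  by_contra hne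
  rcases ha with ha | ha | ha <;> rcases hb with hb | hb | hb <;> rcases hc with hc | hc | hc <;>
    first
    | omega
    | exact h.false_of_type_cosmall_comiddle_colarge hpp hqq hss ht hV (by omega) (by omega)
        (by omega) (by omega) (by omega) (by omega)
    | exact h.swap₁₂.false_of_type_cosmall_comiddle_colarge hqq hpp hss ht hV (by omega)
        (by omega) (by omega) (by omega) (by omega) (by omega)
    | exact h.swap₂₃.false_of_type_cosmall_comiddle_colarge hpp hss hqq ht hV (by omega)
        (by omega) (by omega) (by omega) (by omega) (by omega)
    | exact h.swap₁₂.swap₂₃.false_of_type_cosmall_comiddle_colarge hqq hss hpp ht hV (by omega)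
        (by omega) (by omega) (by omega) (by omega) (by omega)
    | exact h.swap₂₃.swap₁₂.false_of_type_cosmall_comiddle_colarge hss hpp hqq ht hV (by omega)
        (by omega) (by omega) (by omega) (by omega) (by omega)
    | exact h.swap₁₂.swap₂₃.swap₁₂.false_of_type_cosmall_comiddle_colarge hss hqq hpp ht hV
        (by omega) (by omega) (by omega) (by omega) (by omega) (by omega)

/-- The Tits form of a brick, branch by branch. -/
theorem IsBrick.sum_branchForm_le {p c q d s e : Submodule K V}
    (h : IsBrick p (p ⊔ c) q (q ⊔ d) s (s ⊔ e)) {N a1 a2 b1 b2 c1 c2 : ℕ} (hV : finrank K V = N)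
    (hp : finrank K p = a1) (hc : finrank K c = a2)
    (hp' : finrank K (p ⊔ c : Submodule K V) = a1 + a2)
    (hq : finrank K q = b1) (hd : finrank K d = b2)
    (hq' : finrank K (q ⊔ d : Submodule K V) = b1 + b2)
    (hs : finrank K s = c1) (he : finrank K e = c2)
    (hs' : finrank K (s ⊔ e : Submodule K V) = c1 + c2) :
    branchForm N a1 a2 + branchForm N b1 b2 + branchForm N c1 c2 ≤ 3 := by
  have hquot : ∀ A : Submodule K V, (finrank K (V ⧸ A) : ℤ) = N - finrank K A := fun A => by
    have := A.finrank_quotient_add_finrank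
    omega
  have key := h.finrank_sq_le
  zify at key
  simp only [hquot, hV, hp, hc, hp', hq, hd, hq', hs, he, hs'] at key
  push_cast at key
  unfold branchForm
  linarith

end Exclusion

section Cases

open Module

theorem IsProjection.finrank_range_sup {m : ℕ} {P Q : Matrix (Fin m) (Fin m) ℂ}
    (hP : IsProjection P) (hQ : IsProjection Q) (h : P * Q = 0) :
    finrank ℂ (LinearMap.range P.mulVecLin ⊔ LinearMap.range Q.mulVecLin :
      Submodule ℂ (Fin m → ℂ)) = P.rank + Q.rank := by
  rw [← hP.range_add hQ h, ← hP.rank_add hQ h]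
  rfl

theorem exists_isListed_of_three_mul {n : Fin 7 → ℕ} {t : ℕ} (hpos : ∀ i, 0 < n i)
    (hN : n 6 = 3 * t) (hP : n 0 + n 1 < n 6) (hQ : n 2 + n 3 < n 6) (hS : n 4 + n 5 < n 6)
    (hT : branchForm (n 6) (n 0) (n 1) + branchForm (n 6) (n 2) (n 3) +
      branchForm (n 6) (n 4) (n 5) ≤ 3)
    (hne : ¬(n 0 = t ∧ n 1 = t ∧ n 2 = t ∧ n 3 = t ∧ n 4 = t ∧ n 5 = t)) :
    ∃ σ, IsListed (permDim σ n) := by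
  rw [show (n 6 : ℤ) = 3 * t by omega] at hT
  have h0 := branchForm_nonneg (3 * t) (n 0) (n 1)
  have h1 := branchForm_nonneg (3 * t) (n 2) (n 3)
  have h2 := branchForm_nonneg (3 * t) (n 4) (n 5)
  rcases branchForm_three_mul (t := t) (a1 := n 0) (a2 := n 1) (by omega)
    with ⟨ea, ha1, ha2⟩ | ⟨ea, ha⟩ <;>
  rcases branchForm_three_mul (t := t) (a1 := n 2) (a2 := n 3) (by omega)
    with ⟨eb, hb1, hb2⟩ | ⟨eb, hb⟩ <;>
  rcases branchForm_three_mul (t := t) (a1 := n 4) (a2 := n 5) (by omega)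
    with ⟨ec, hc1, hc2⟩ | ⟨ec, hc⟩ <;> try omega
  · apply exists_isListed_permDim_of_third
    rw [ha1, ha2, hb1, hb2]
    exact isListed_of_shapeZero hc (hpos 4) (hpos 5) hS hN
  · apply exists_isListed_permDim_of_second
    rw [ha1, ha2, hc1, hc2]
    exact isListed_of_shapeZero hb (hpos 2) (hpos 3) hQ hN
  · apply exists_isListed_permDim_of_first
    rw [hb1, hb2, hc1, hc2]
    exact isListed_of_shapeZero ha (hpos 0) (hpos 1) hP hN

end Cases

/-- Away from the hyperplane `α1+α2+β1+β2+δ1+δ2 = 3γ`, the generalized dimension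
of any irreducible non-degenerate *-representation of `A(Ẽ6,χ)` is, up to a
permutation of the three branch pairs, of the form `M_d d_k` for some `d_k` in
one of the three families. -/
theorem repE6_dim_classification (α1 α2 β1 β2 δ1 δ2 γ : ℝ)
    (hα1 : α2 < α1) (hα2 : 0 < α2) (hβ1 : β2 < β1) (hβ2 : 0 < β2)
    (hδ1 : δ2 < δ1) (hδ2 : 0 < δ2) (hγ : 0 < γ)
    (hsum : α1 + α2 + β1 + β2 + δ1 + δ2 ≠ 3 * γ)
    (n : Fin 7 → ℕ) (hrep : HasIrrNondegRep α1 α2 β1 β2 δ1 δ2 γ n) :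
    ∃ σ : Equiv.Perm (Fin 3),
      (∃ k : ℕ, 15 ≤ k ∧ ∀ i, (permDim σ n i : ℤ) = (MdZ *ᵥ dFamI k) i) ∨
      (∃ k : ℕ, 8 ≤ k ∧ ∀ i, (permDim σ n i : ℤ) = (MdZ *ᵥ dFamII k) i) ∨
      (∃ k : ℕ, 5 ≤ k ∧ ∀ i, (permDim σ n i : ℤ) = (MdZ *ᵥ dFamIII k) i) := by
  obtain ⟨hpos, P1, P2, Q1, Q2, S1, S2, hrep, hnd, hirr⟩ := hrep
  have hB := isBrick_of_isIrredRep hα1 hα2 hβ1 hβ2 hδ1 hδ2 hrep hirr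
  have htr := hrep.trace_relation
  obtain ⟨hP1, hP2, hQ1, hQ2, hS1, hS2, hP, hQ, hS, rP1, rP2, rQ1, rQ2, rS1, rS2, -⟩ := hrep
  have hP' := hP1.finrank_range_sup hP2 hP
  have hQ' := hQ1.finrank_range_sup hQ2 hQ
  have hS' := hS1.finrank_range_sup hS2 hS
  have ltP := (hP1.add hP2 hP).rank_lt hnd.1
  have ltQ := (hQ1.add hQ2 hQ).rank_lt hnd.2.1
  have ltS := (hS1.add hS2 hS).rank_lt hnd.2.2
  rw [hP1.rank_add hP2 hP] at ltP
  rw [hQ1.rank_add hQ2 hQ] at ltQ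
  rw [hS1.rank_add hS2 hS] at ltS
  rw [rP1, rP2] at hP' ltP
  rw [rQ1, rQ2] at hQ' ltQ
  rw [rS1, rS2] at hS' ltS
  have hV : Module.finrank ℂ (Fin (n 6) → ℂ) = n 6 := by simp
  have hT := hB.sum_branchForm_le hV rP1 rP2 hP' rQ1 rQ2 hQ' rS1 rS2 hS'
  have pos0 := hpos 0
  have pos1 := hpos 1
  change ∃ σ, IsListed (permDim σ n)
  obtain ⟨t, hN | hN | hN⟩ : ∃ t, n 6 = 3 * t ∨ n 6 = 3 * t + 1 ∨ n 6 = 3 * t + 2 :=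
    ⟨n 6 / 3, by omega⟩
  · refine exists_isListed_of_three_mul hpos hN ltP ltQ ltS hT
      fun ⟨h0, h1, h2, h3, h4, h5⟩ => hsum ?_
    have ht : (t : ℝ) ≠ 0 := by
      have : t ≠ 0 := by omega
      exact_mod_cast this
    rw [h0, h1, h2, h3, h4, h5, hN] at htr
    push_cast at htr
    exact mul_right_cancel₀ ht (by linarith)
  · rw [show (n 6 : ℤ) = 3 * t + 1 by omega] at hT
    obtain ⟨la, sa⟩ := branchForm_three_mul_add_one t (n 0) (n 1)
    obtain ⟨lb, sb⟩ := branchForm_three_mul_add_one t (n 2) (n 3)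
    obtain ⟨lc, sc⟩ := branchForm_three_mul_add_one t (n 4) (n 5)
    have ha := sa (by omega)
    have hb := sb (by omega)
    have hc := sc (by omega)
    have ht : 0 < t := by omega
    obtain ⟨hmid, ⟨e1, e2⟩ | ⟨e1, e2⟩ | ⟨e1, e2⟩⟩ :=
      hB.two_shapes_eq_of_shapeOne le_sup_left le_sup_left le_sup_left ht (hV.trans hN)
        rP1 hP' rQ1 hQ' rS1 hS' ha hb hc
    · apply exists_isListed_permDim_of_first
      rw [← e1, ← e2]
      exact isListed_of_shapeOne ha hb ht hN (by omega)
    · apply exists_isListed_permDim_of_second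
      rw [← e1, ← e2]
      exact isListed_of_shapeOne hb ha ht hN (by omega)
    · apply exists_isListed_permDim_of_third
      rw [← e1, ← e2]
      exact isListed_of_shapeOne hc ha ht hN (by omega)
  · rw [show (n 6 : ℤ) = 3 * t + 2 by omega] at hT
    obtain ⟨la, sa⟩ := branchForm_three_mul_add_two t (n 0) (n 1)
    obtain ⟨lb, sb⟩ := branchForm_three_mul_add_two t (n 2) (n 3)
    obtain ⟨lc, sc⟩ := branchForm_three_mul_add_two t (n 4) (n 5)
    have ha := sa (by omega)
    have hb := sb (by omega)
    have hc := sc (by omega)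
    have ht : 0 < t := by omega
    obtain ⟨hmid, ⟨e1, e2⟩ | ⟨e1, e2⟩ | ⟨e1, e2⟩⟩ :=
      hB.two_shapes_eq_of_shapeTwo le_sup_left le_sup_left le_sup_left ht (hV.trans hN)
        rP1 hP' rQ1 hQ' rS1 hS' ha hb hc
    · apply exists_isListed_permDim_of_first
      rw [← e1, ← e2]
      exact isListed_of_shapeTwo ha hb ht hN (by omega)
    · apply exists_isListed_permDim_of_second
      rw [← e1, ← e2]
      exact isListed_of_shapeTwo hb ha ht hN (by omega)
    · apply exists_isListed_permDim_of_third
      rw [← e1, ← e2]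
      exact isListed_of_shapeTwo hc ha ht hN (by omega)

end
end

section
/- Suppose α1 + α2 + β1 + β2 + δ1 + δ2 = 3γ, and suppose the algebra A(Ẽ6,χ) admits an irreducible non-degenerate *-representation in generalized dimension n = (n1,n2,n3,n4,n5,n6,n0). Then either n = (1,1,1,1,1,1,3), or the corresponding graph dimension vector d = (n2, n1+n2, n4, n3+n4, n6, n5+n6, n0) is a real root of the Tits form of Ẽ6, i.e. q(d) = 1. -/
open Matrix

/-- The Tits quadratic form of the extended Dynkin graph `Ẽ6`, over `ℤ`.
Coordinates are indexed so that `x i` for `i = 0,…,5` are `x1,…,x6`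
(the vertices `g1,…,g6`) and `x 6` is `x0` (the central vertex `g0`). -/
def titsE6 (x : Fin 7 → ℤ) : ℤ :=
  x 0 ^ 2 + x 1 ^ 2 + x 2 ^ 2 + x 3 ^ 2 + x 4 ^ 2 + x 5 ^ 2 + x 6 ^ 2
    - x 0 * x 1 - x 2 * x 3 - x 4 * x 5 - x 6 * (x 1 + x 3 + x 5)

/-- Two endomorphisms `x`, `y` whose cubic equations, together with that of `x + y`, are those of
an `Ẽ6` triple on the hyperplane where the sum of the three traces is balanced: `P` is the
projection onto the kernel of `x`, the nonzero eigenvalues of `x` are the roots of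
`X² - p X + m`, and the quadratic coefficient for `x + y` is the sum of those for `x` and `y`. -/
structure BalancedPair {V : Type*} [AddCommGroup V] [Module ℂ V]
    (p m b c e f : ℂ) (x y P : Module.End ℂ V) : Prop where
  proj_proj : ∀ w, P (P w) = P w
  proj_fst : ∀ w, P (x w) = 0
  fst_proj : ∀ w, x (P w) = 0
  fst_fst : ∀ w, x (x w) = p • x w - m • w + m • P w
  snd_cube : ∀ w, y (y (y w)) = b • y (y w) + c • y w
  add_cube : ∀ w, x (x (x w)) + x (x (y w)) + x (y (x w)) + x (y (y w)) + y (x (x w)) +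
      y (x (y w)) + y (y (x w)) + y (y (y w)) =
    (p + b) • (x (x w) + x (y w) + y (x w) + y (y w)) + e • (x w + y w) + f • w

lemma exists_eigenvector_mem {V : Type*} [AddCommGroup V] [Module ℂ V] [FiniteDimensional ℂ V]
    (g : Module.End ℂ V) (E : Submodule ℂ V) (hE : E ≠ ⊥) (hg : ∀ w ∈ E, g w ∈ E) :
    ∃ v ∈ E, v ≠ 0 ∧ ∃ a : ℂ, g v = a • v := by
  have : Nontrivial E := Submodule.nontrivial_iff_ne_bot.mpr hE
  obtain ⟨a, ha⟩ := Module.End.exists_eigenvalue (g.restrict hg)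
  obtain ⟨v, hv⟩ := ha.exists_hasEigenvector
  refine ⟨v, v.2, fun h => hv.2 (Subtype.ext h), a, ?_⟩
  exact congrArg Subtype.val hv.apply_eq_smul

namespace BalancedPair

variable {V : Type*} [AddCommGroup V] [Module ℂ V] {p m b c e f : ℂ} {x y P : Module.End ℂ V}

/-- On the range of `P` the compressions of `y` and `y²` commute. -/
lemma compressions_commute (h : BalancedPair p m b c e f x y P) (hm : m ≠ 0) {w : V}
    (hw : P w = w) : P (y (P (y (y w)))) = P (y (y (P (y w)))) := by
  have hxw : x w = 0 := by rw [← hw, h.fst_proj]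
  have left := congrArg P (h.add_cube (y (y w)))
  have right := congrArg (fun u => P (y (y u))) (h.add_cube w)
  have hleft := congrArg (fun u => P (y u)) (h.fst_fst (y (y w)))
  have hright := congrArg (fun u => P (y (y u))) (h.fst_fst (y w))
  simp only [map_add, map_sub, map_smul, h.proj_fst, h.snd_cube, hxw, map_zero] at *
  refine smul_right_injective V hm ?_
  simp only
  linear_combination (norm := module) hright - right - hleft + left

/-- For a joint eigenvector `v` of the compressions of `y` and `y²`, the span of the vectors
`v`, `y v`, `y² v`, `x y v`, `x y² v`, `y x y² v` is closed under `x` and `y`: the product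
`y x y v`. -/
lemma snd_fst_snd_apply (h : BalancedPair p m b c e f x y P) {v : V} {s : ℂ}
    (hv : P v = v) (hs : P (y v) = s • v) :
    y (x (y v)) = (f - m * s) • v + (e - c + m) • y v + p • y (y v) + b • x (y v) -
      x (y (y v)) := by
  have hxv : x v = 0 := by rw [← hv, h.fst_proj]
  have hrel := h.add_cube v
  simp only [hxv, map_zero, h.fst_fst, hs, h.snd_cube] at hrel
  linear_combination (norm := module) hrel

/-- The product `y² x y² v` for a joint eigenvector `v` of the compressions. -/
lemma snd_snd_fst_snd_snd_apply (h : BalancedPair p m b c e f x y P) {v : V} {s : ℂ}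
    (hv : P v = v) (hs : P (y v) = s • v) :
    y (y (x (y (y v)))) = (m * c * s - c * f) • v + (p * b * c) • y v +
      (f + b * e - b * c - m * s + m * b + p * b ^ 2) • y (y v) - (b * c) • x (y v) +
      c • x (y (y v)) := by
  have hyxy := h.snd_fst_snd_apply hv hs
  have hcube := h.snd_cube (x (y v))
  simp only [hyxy, map_add, map_sub, map_smul, h.snd_cube] at hcube
  linear_combination (norm := module) -hcube

/-- The product `x y x y² v` for a joint eigenvector `v` of the compressions. -/
lemma fst_snd_fst_snd_snd_apply (h : BalancedPair p m b c e f x y P) {v : V} {s t : ℂ}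
    (hv : P v = v) (hs : P (y v) = s • v) (ht : P (y (y v)) = t • v) :
    x (y (x (y (y v)))) = -(m * c * s) • v + (m * (c - t)) • y v + (m * s) • y (y v) +
      (e - c + m + p * b) • x (y (y v)) := by
  have hxv : x v = 0 := by rw [← hv, h.fst_proj]
  have hyxy := h.snd_fst_snd_apply hv hs
  have hyyxyy := h.snd_snd_fst_snd_snd_apply hv hs
  have hrel := h.add_cube (y (y v))
  simp only [hyxy, hyyxyy, map_add, map_sub, map_smul, h.snd_cube, h.fst_fst, hs, ht, hxv, smul_zero] at hrel
  linear_combination (norm := module) hrel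

/-- The compression `P y x y²` applied to a joint eigenvector `v` of the compressions of `y`
and `y²`. -/
lemma proj_snd_fst_snd_snd_apply (h : BalancedPair p m b c e f x y P) (hm : m ≠ 0) {v : V}
    {s t : ℂ} (hv : P v = v) (hs : P (y v) = s • v) (ht : P (y (y v)) = t • v) :
    P (y (x (y (y v)))) = ((e - c + m + p * b) * t + p * c * s) • v + (p * (t - c)) • y v -
      (e - c + m + p * b + p * s) • y (y v) + (c - t) • x (y v) + s • x (y (y v)) +
      y (x (y (y v))) := by
  have hxv : x v = 0 := by rw [← hv, h.fst_proj]
  have hX := h.fst_snd_fst_snd_snd_apply hv hs ht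
  have hrel := h.fst_fst (y (x (y (y v))))
  simp only [hX, map_add, map_smul, h.fst_fst, hxv, ht] at hrel
  refine smul_right_injective V hm ?_
  simp only
  linear_combination (norm := module) -hrel

/-- The compression `P y x y²` preserves the joint eigenspaces of the compressions of `y`
and `y²`. -/
lemma compression_eigen (h : BalancedPair p m b c e f x y P) (hm : m ≠ 0) {v : V}
    {s t : ℂ} (hv : P v = v) (hs : P (y v) = s • v) (ht : P (y (y v)) = t • v) :
    P (y (P (y (x (y (y v)))))) = s • P (y (x (y (y v)))) ∧
      P (y (y (P (y (x (y (y v))))))) = t • P (y (x (y (y v)))) := by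
  have hyxy := h.snd_fst_snd_apply hv hs
  have hR := h.proj_snd_fst_snd_snd_apply hm hv hs ht
  have hY := h.snd_snd_fst_snd_snd_apply hv hs
  constructor
  · rw [hR]
    simp only [map_add, map_sub, map_smul, hyxy, hY, h.snd_cube, h.proj_fst, hv, hs, ht]
    rw [hR]
    module
  · rw [hR]
    simp only [map_add, map_sub, map_smul, hyxy, hY, h.snd_cube, h.proj_fst, hv, hs, ht]
    rw [hR]
    module

/-- If `P ≠ 0`, there are a nonzero vector `v` and a subspace containing `v`, invariant under `x`
and `y`, whose image under `P` lies in the line through `v`. -/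
theorem exists_invariant_submodule [FiniteDimensional ℂ V] (h : BalancedPair p m b c e f x y P)
    (hm : m ≠ 0) (hP : P ≠ 0) :
    ∃ v : V, v ≠ 0 ∧ ∃ W : Submodule ℂ V, v ∈ W ∧ (∀ w ∈ W, x w ∈ W) ∧ (∀ w ∈ W, y w ∈ W) ∧
      ∀ w ∈ W, P w ∈ Submodule.span ℂ {v} := by
  have hE₀ : LinearMap.range P ≠ ⊥ := by rwa [Ne, LinearMap.range_eq_bot]
  have fixed : ∀ w ∈ LinearMap.range P, P w = w := by
    rintro _ ⟨w, rfl⟩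
    exact h.proj_proj w
  obtain ⟨v₁, hv₁, hv₁0, s, hs₁⟩ := exists_eigenvector_mem (P * y) _ hE₀
    fun w _ => LinearMap.mem_range_self P (y w)
  obtain ⟨v₂, ⟨hv₂, hs₂⟩, hv₂0, t, ht₂⟩ := exists_eigenvector_mem (P * y * y)
    (LinearMap.range P ⊓ LinearMap.ker (P * y - s • 1))
    (fun hbot => hv₁0 ((Submodule.mem_bot ℂ).mp (hbot ▸ ⟨hv₁, by
      simpa [sub_eq_zero] using hs₁⟩)))
    (by
      rintro w ⟨hw, hws⟩
      refine ⟨LinearMap.mem_range_self P _, ?_⟩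
      have hs : P (y w) = s • w := by simpa [sub_eq_zero] using hws
      have := h.compressions_commute hm (fixed w hw)
      simpa [sub_eq_zero, hs] using this)
  obtain ⟨v, ⟨⟨hv', hs'⟩, ht'⟩, hv0, r, hr⟩ := exists_eigenvector_mem (P * y * x * y * y)
    (LinearMap.range P ⊓ LinearMap.ker (P * y - s • 1) ⊓ LinearMap.ker (P * y * y - t • 1))
    (fun hbot => hv₂0 ((Submodule.mem_bot ℂ).mp (hbot ▸ ⟨⟨hv₂, hs₂⟩, by
      simpa [sub_eq_zero] using ht₂⟩)))
    (by
      rintro w ⟨⟨hw, hws⟩, hwt⟩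
      have hs : P (y w) = s • w := by simpa [sub_eq_zero] using hws
      have ht : P (y (y w)) = t • w := by simpa [sub_eq_zero] using hwt
      have := h.compression_eigen hm (fixed w hw) hs ht
      refine ⟨⟨LinearMap.mem_range_self P _, ?_⟩, ?_⟩
      · simpa [sub_eq_zero] using this.1
      · simpa [sub_eq_zero] using this.2)
  have hv : P v = v := fixed v hv'
  have hs : P (y v) = s • v := by simpa [sub_eq_zero] using hs'
  have ht : P (y (y v)) = t • v := by simpa [sub_eq_zero] using ht'
  have hr : P (y (x (y (y v)))) = r • v := by simpa using hr
  have hxv : x v = 0 := by rw [← hv, h.fst_proj]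
  set S : Set V := {v, y v, y (y v), x (y v), x (y (y v)), y (x (y (y v)))} with hS
  have m₀ : v ∈ Submodule.span ℂ S := Submodule.subset_span (by simp [hS])
  have m₁ : y v ∈ Submodule.span ℂ S := Submodule.subset_span (by simp [hS])
  have m₂ : y (y v) ∈ Submodule.span ℂ S := Submodule.subset_span (by simp [hS])
  have m₃ : x (y v) ∈ Submodule.span ℂ S := Submodule.subset_span (by simp [hS])
  have m₄ : x (y (y v)) ∈ Submodule.span ℂ S := Submodule.subset_span (by simp [hS])
  have m₅ : y (x (y (y v))) ∈ Submodule.span ℂ S := Submodule.subset_span (by simp [hS])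
  have closed (g : Module.End ℂ V) (T : Submodule ℂ V) (hg : ∀ u ∈ S, g u ∈ T) :
      ∀ w ∈ Submodule.span ℂ S, g w ∈ T := fun w hw =>
    (Submodule.span_le (p := T.comap g)).mpr hg hw
  refine ⟨v, hv0, Submodule.span ℂ S, m₀, closed x _ ?_, closed y _ ?_, closed P _ ?_⟩
  · rintro u (rfl | rfl | rfl | rfl | rfl | rfl)
    · simp [hxv]
    · exact m₃
    · exact m₄
    · rw [h.fst_fst, hs]
      exact add_mem (sub_mem (Submodule.smul_mem _ _ m₃) (Submodule.smul_mem _ _ m₁))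
        (Submodule.smul_mem _ _ (Submodule.smul_mem _ _ m₀))
    · rw [h.fst_fst, ht]
      exact add_mem (sub_mem (Submodule.smul_mem _ _ m₄) (Submodule.smul_mem _ _ m₂))
        (Submodule.smul_mem _ _ (Submodule.smul_mem _ _ m₀))
    · rw [h.fst_snd_fst_snd_snd_apply hv hs ht]
      exact add_mem (add_mem (add_mem (Submodule.smul_mem _ _ m₀) (Submodule.smul_mem _ _ m₁))
        (Submodule.smul_mem _ _ m₂)) (Submodule.smul_mem _ _ m₄)
  · rintro u (rfl | rfl | rfl | rfl | rfl | rfl)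
    · exact m₁
    · exact m₂
    · rw [h.snd_cube]
      exact add_mem (Submodule.smul_mem _ _ m₂) (Submodule.smul_mem _ _ m₁)
    · rw [h.snd_fst_snd_apply hv hs]
      exact sub_mem (add_mem (add_mem (add_mem (Submodule.smul_mem _ _ m₀)
        (Submodule.smul_mem _ _ m₁)) (Submodule.smul_mem _ _ m₂)) (Submodule.smul_mem _ _ m₃)) m₄
    · exact m₅
    · rw [h.snd_snd_fst_snd_snd_apply hv hs]
      exact add_mem (sub_mem (add_mem (add_mem (Submodule.smul_mem _ _ m₀)
        (Submodule.smul_mem _ _ m₁)) (Submodule.smul_mem _ _ m₂)) (Submodule.smul_mem _ _ m₃))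
        (Submodule.smul_mem _ _ m₄)
  · rintro u (rfl | rfl | rfl | rfl | rfl | rfl)
    · simp [hv, Submodule.mem_span_singleton_self]
    · exact Submodule.mem_span_singleton.mpr ⟨s, hs.symm⟩
    · exact Submodule.mem_span_singleton.mpr ⟨t, ht.symm⟩
    · simp [h.proj_fst]
    · simp [h.proj_fst]
    · exact Submodule.mem_span_singleton.mpr ⟨r, hr.symm⟩

end BalancedPair

lemma trace_mulLeft_comp_mulRight {ι : Type*} [Fintype ι] [DecidableEq ι] (A B : Matrix ι ι ℂ) :
    LinearMap.trace ℂ (Matrix ι ι ℂ) (LinearMap.mulLeft ℂ A ∘ₗ LinearMap.mulRight ℂ B) =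
      A.trace * B.trace := by
  rw [LinearMap.trace_eq_matrix_trace ℂ (Matrix.stdBasis ℂ ι ι), Matrix.trace,
    Fintype.sum_prod_type, Matrix.trace, Matrix.trace, Finset.sum_mul_sum]
  refine Finset.sum_congr rfl fun i _ => Finset.sum_congr rfl fun j _ => ?_
  rw [Matrix.diag_apply, LinearMap.toMatrix_apply, Matrix.stdBasis_eq_single]
  have repr_apply (M : Matrix ι ι ℂ) : (Matrix.stdBasis ℂ ι ι).repr M (i, j) = M i j := by
    simp [Matrix.stdBasis]
  rw [repr_apply]
  simp [Matrix.mul_apply, Matrix.single_apply, ite_and]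

namespace IsProjection

variable {n : ℕ} {P Q : Matrix (Fin n) (Fin n) ℂ}

lemma trace_eq_rank_s14 (hP : IsProjection P) : P.trace = P.rank := by
  have hproj : LinearMap.IsProj (LinearMap.range P.toLin') P.toLin' := by
    refine ⟨fun w => LinearMap.mem_range_self _ w, ?_⟩
    rintro _ ⟨w, rfl⟩
    rw [← Matrix.toLin'_mul_apply, hP.2]
  rw [← Matrix.trace_toLin'_eq, hproj.trace]
  rfl

lemma mul_eq_zero_comm (hP : IsProjection P) (hQ : IsProjection Q) (h : P * Q = 0) :
    Q * P = 0 := by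
  simpa [hP.1.eq, hQ.1.eq] using congrArg Matrix.conjTranspose h

lemma one_sub_sub (hP : IsProjection P) (hQ : IsProjection Q) (h : P * Q = 0) :
    IsProjection (1 - P - Q) := by
  refine ⟨(Matrix.isHermitian_one.sub hP.1).sub hQ.1, ?_⟩
  simp only [mul_sub, sub_mul, mul_one, one_mul, hP.2, hQ.2, h, hP.mul_eq_zero_comm hQ h]
  abel

lemma rank_one_sub_sub (hP : IsProjection P) (hQ : IsProjection Q) (h : P * Q = 0) :
    P.rank + Q.rank + (1 - P - Q).rank = n := by
  have := (hP.one_sub_sub hQ h).trace_eq_rank_s14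
  rw [Matrix.trace_sub, Matrix.trace_sub, hP.trace_eq_rank_s14, hQ.trace_eq_rank_s14, Matrix.trace_one,
    Fintype.card_fin] at this
  have key : ((P.rank + Q.rank + (1 - P - Q).rank : ℕ) : ℂ) = n := by
    push_cast
    linear_combination -this
  exact_mod_cast key

variable {a b : ℂ}

lemma combination_mul_self (hP : IsProjection P) (hQ : IsProjection Q) (h : P * Q = 0) :
    (a • P + b • Q) * (a • P + b • Q) =
      (a + b) • (a • P + b • Q) - (a * b) • (1 : Matrix (Fin n) (Fin n) ℂ) +
        (a * b) • (1 - P - Q) := by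
  simp only [mul_add, add_mul, smul_mul_assoc, mul_smul_comm, hP.2, hQ.2, h,
    hP.mul_eq_zero_comm hQ h]
  module

lemma one_sub_sub_mul_combination (hP : IsProjection P) (hQ : IsProjection Q) (h : P * Q = 0) :
    (1 - P - Q) * (a • P + b • Q) = 0 := by
  simp only [mul_add, sub_mul, mul_smul_comm, hP.2, hQ.2, h, hP.mul_eq_zero_comm hQ h, one_mul]
  module

lemma combination_mul_one_sub_sub (hP : IsProjection P) (hQ : IsProjection Q) (h : P * Q = 0) :
    (a • P + b • Q) * (1 - P - Q) = 0 := by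
  simp only [mul_sub, add_mul, smul_mul_assoc, hP.2, hQ.2, h, hP.mul_eq_zero_comm hQ h, mul_one]
  module

lemma combination_cube (hP : IsProjection P) (hQ : IsProjection Q) (h : P * Q = 0) :
    (a • P + b • Q) * ((a • P + b • Q) * (a • P + b • Q)) =
      (a + b) • ((a • P + b • Q) * (a • P + b • Q)) + (-(a * b)) • (a • P + b • Q) := by
  rw [← mul_assoc]
  nth_rewrite 1 [hP.combination_mul_self hQ h]
  rw [add_mul, sub_mul, smul_mul_assoc, smul_mul_assoc, smul_mul_assoc,
    hP.one_sub_sub_mul_combination hQ h, one_mul]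
  module

/-- The spectral projections are polynomials in the combination, hence have the same commutant. -/
lemma commute_of_commute_combination (hP : IsProjection P) (hQ : IsProjection Q) (h : P * Q = 0)
    (ha : a ≠ 0) (hb : b ≠ 0) (hab : a ≠ b) {X : Matrix (Fin n) (Fin n) ℂ}
    (hX : Commute X (a • P + b • Q)) : Commute X P ∧ Commute X Q := by
  have hAA := hP.combination_mul_self (a := a) (b := b) hQ h
  have hP' : P = (a * (a - b))⁻¹ •
      ((a • P + b • Q) * (a • P + b • Q) - b • (a • P + b • Q)) := by
    rw [eq_inv_smul_iff₀ (mul_ne_zero ha (sub_ne_zero.mpr hab)), hAA]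
    module
  have hQ' : Q = (b * (b - a))⁻¹ •
      ((a • P + b • Q) * (a • P + b • Q) - a • (a • P + b • Q)) := by
    rw [eq_inv_smul_iff₀ (mul_ne_zero hb (sub_ne_zero.mpr hab.symm)), hAA]
    module
  constructor
  · rw [hP']
    exact ((hX.mul_right hX).sub_right (hX.smul_right b)).smul_right _
  · rw [hQ']
    exact ((hX.mul_right hX).sub_right (hX.smul_right a)).smul_right _

end IsProjection

/-- The inner derivation `X ↦ A X - X A`. -/
noncomputable def innerDerivation {n : ℕ} (A : Matrix (Fin n) (Fin n) ℂ) :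
    Module.End ℂ (Matrix (Fin n) (Fin n) ℂ) :=
  LinearMap.mulLeft ℂ A - LinearMap.mulRight ℂ A

lemma innerDerivation_apply {n : ℕ} (A X : Matrix (Fin n) (Fin n) ℂ) :
    innerDerivation A X = A * X - X * A := rfl

lemma mem_ker_innerDerivation {n : ℕ} {A X : Matrix (Fin n) (Fin n) ℂ} :
    X ∈ LinearMap.ker (innerDerivation A) ↔ Commute X A := by
  rw [LinearMap.mem_ker, innerDerivation_apply, sub_eq_zero, eq_comm]
  rfl

/-- The dimension of the commutant of a matrix with eigenvalues `a`, `b`, `0`. -/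
lemma finrank_ker_innerDerivation {n : ℕ} {P Q : Matrix (Fin n) (Fin n) ℂ} {a b : ℂ}
    (hP : IsProjection P) (hQ : IsProjection Q) (h : P * Q = 0)
    (ha : a ≠ 0) (hb : b ≠ 0) (hab : a ≠ b) :
    Module.finrank ℂ (LinearMap.ker (innerDerivation (a • P + b • Q))) =
      P.rank ^ 2 + Q.rank ^ 2 + (1 - P - Q).rank ^ 2 := by
  have hR := hP.one_sub_sub hQ h
  have hQP := hP.mul_eq_zero_comm hQ h
  set T : Module.End ℂ (Matrix (Fin n) (Fin n) ℂ) :=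
    LinearMap.mulLeft ℂ P ∘ₗ LinearMap.mulRight ℂ P +
      LinearMap.mulLeft ℂ Q ∘ₗ LinearMap.mulRight ℂ Q +
      LinearMap.mulLeft ℂ (1 - P - Q) ∘ₗ LinearMap.mulRight ℂ (1 - P - Q) with hT
  have hTX (X : Matrix (Fin n) (Fin n) ℂ) :
      T X = P * (X * P) + Q * (X * Q) + (1 - P - Q) * (X * (1 - P - Q)) := rfl
  have hproj : LinearMap.IsProj (LinearMap.ker (innerDerivation (a • P + b • Q))) T := by
    refine ⟨fun X => ?_, fun X hX => ?_⟩
    · rw [mem_ker_innerDerivation, Commute, SemiconjBy, hTX]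
      have left : (P * (X * P) + Q * (X * Q) + (1 - P - Q) * (X * (1 - P - Q))) *
          (a • P + b • Q) = a • (P * (X * P)) + b • (Q * (X * Q)) := by
        simp only [add_mul _ _ (a • P + b • Q), mul_assoc, hP.one_sub_sub_mul_combination hQ h]
        simp only [mul_add, mul_smul_comm, hP.2, hQ.2, h, hQP, mul_zero, smul_zero, add_zero,
          zero_add]
      have right : (a • P + b • Q) *
          (P * (X * P) + Q * (X * Q) + (1 - P - Q) * (X * (1 - P - Q))) =
            a • (P * (X * P)) + b • (Q * (X * Q)) := by
        simp only [mul_add (a • P + b • Q), ← mul_assoc, hP.combination_mul_one_sub_sub hQ h]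
        simp only [add_mul, smul_mul_assoc, hP.2, hQ.2, h, hQP, zero_mul, smul_zero, add_zero,
          zero_add]
      rw [left, right]
    · obtain ⟨hXP, hXQ⟩ := hP.commute_of_commute_combination hQ h ha hb hab
        (mem_ker_innerDerivation.mp hX)
      have hXR : Commute X (1 - P - Q) := ((Commute.one_right X).sub_right hXP).sub_right hXQ
      rw [hTX, hXP.eq, hXQ.eq, hXR.eq, ← mul_assoc, ← mul_assoc, ← mul_assoc, hP.2, hQ.2, hR.2,
        ← add_mul, ← add_mul]
      simp
  have key : ((Module.finrank ℂ (LinearMap.ker (innerDerivation (a • P + b • Q))) : ℕ) : ℂ) =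
      (P.rank ^ 2 + Q.rank ^ 2 + (1 - P - Q).rank ^ 2 : ℕ) := by
    rw [← hproj.trace, hT, map_add, map_add, trace_mulLeft_comp_mulRight,
      trace_mulLeft_comp_mulRight, trace_mulLeft_comp_mulRight, hP.trace_eq_rank_s14,
      hQ.trace_eq_rank_s14, hR.trace_eq_rank_s14]
    push_cast
    ring
  exact_mod_cast key

open scoped ComplexOrder in
/-- The rigidity inequality: an irreducible triple of Hermitian matrices with scalar sum has
commutants of total dimension at most `n² + 2`. -/
lemma sum_finrank_ker_innerDerivation_le {n : ℕ} {A B C : Matrix (Fin n) (Fin n) ℂ} {g : ℂ}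
    (hA : A.IsHermitian) (hB : B.IsHermitian)
    (hsum : A + B + C = g • (1 : Matrix (Fin n) (Fin n) ℂ))
    (hirr : ∀ X, Commute X A → Commute X B → ∃ c : ℂ, X = c • (1 : Matrix (Fin n) (Fin n) ℂ)) :
    Module.finrank ℂ (LinearMap.ker (innerDerivation A)) +
      Module.finrank ℂ (LinearMap.ker (innerDerivation B)) +
      Module.finrank ℂ (LinearMap.ker (innerDerivation C)) ≤ n ^ 2 + 2 := by
  have hC : C = g • (1 : Matrix (Fin n) (Fin n) ℂ) - A - B := by rw [← hsum]; abel
  have hXB {X : Matrix (Fin n) (Fin n) ℂ} (hXA : Commute X A) (hXC : Commute X C) :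
      Commute X B := by
    have : B = g • (1 : Matrix (Fin n) (Fin n) ℂ) - A - C := by rw [← hsum]; abel
    rw [this]
    exact (((Commute.one_right X).smul_right g).sub_right hXA).sub_right hXC
  set KA := LinearMap.ker (innerDerivation A)
  set KB := LinearMap.ker (innerDerivation B)
  set KC := LinearMap.ker (innerDerivation C)
  have scalar_le (K : Submodule ℂ (Matrix (Fin n) (Fin n) ℂ))
      (hK : ∀ X ∈ K, Commute X A ∧ Commute X B) : Module.finrank ℂ K ≤ 1 := by
    have hle : K ≤ Submodule.span ℂ {(1 : Matrix (Fin n) (Fin n) ℂ)} := fun X hX => by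
      obtain ⟨c, rfl⟩ := hirr X (hK X hX).1 (hK X hX).2
      exact Submodule.mem_span_singleton.mpr ⟨c, rfl⟩
    refine (Submodule.finrank_mono hle).trans ((finrank_span_le_card _).trans ?_)
    simp
  have hinf : Module.finrank ℂ ↥(KA ⊓ KB) ≤ 1 := scalar_le _ fun X hX =>
    ⟨mem_ker_innerDerivation.mp hX.1, mem_ker_innerDerivation.mp hX.2⟩
  have hinf' : Module.finrank ℂ ↥(KC ⊓ KA) ≤ 1 := scalar_le _ fun X hX =>
    ⟨mem_ker_innerDerivation.mp hX.2,
      hXB (mem_ker_innerDerivation.mp hX.2) (mem_ker_innerDerivation.mp hX.1)⟩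
  have hker : Module.finrank ℂ (LinearMap.ker ((innerDerivation A).domRestrict KC)) ≤ 1 := by
    rw [← Submodule.finrank_map_subtype_eq]
    refine (Submodule.finrank_mono ?_).trans hinf'
    rintro _ ⟨X, hX, rfl⟩
    exact ⟨X.2, hX⟩
  have hnull := LinearMap.finrank_range_add_finrank_ker ((innerDerivation A).domRestrict KC)
  have hsup := Submodule.finrank_sup_add_finrank_inf_eq KA KB
  have hdisj : Disjoint (LinearMap.range ((innerDerivation A).domRestrict KC)) (KA ⊔ KB) := by
    rw [Submodule.disjoint_def]
    rintro _ ⟨⟨X, hX⟩, rfl⟩ hU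
    obtain ⟨Y, hY, Z, hZ, hYZ⟩ := Submodule.mem_sup.mp hU
    have hYA : Commute Yᴴ A := by
      have := congrArg conjTranspose (mem_ker_innerDerivation.mp hY).eq
      simpa [hA.eq, Commute, SemiconjBy] using this.symm
    have hZB : Commute Zᴴ B := by
      have := congrArg conjTranspose (mem_ker_innerDerivation.mp hZ).eq
      simpa [hB.eq, Commute, SemiconjBy] using this.symm
    have hXC := (mem_ker_innerDerivation.mp hX).eq
    change A * X - X * A = 0
    change Y + Z = A * X - X * A at hYZ
    have hAB : A * X - X * A = X * B - B * X := by
      rw [hC] at hXC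
      simp only [mul_sub, sub_mul, mul_smul_comm, smul_mul_assoc, mul_one, one_mul] at hXC
      linear_combination (norm := abel) hXC
    have orth {D E : Matrix (Fin n) (Fin n) ℂ} (hED : Commute E D) :
        (E * (D * X - X * D)).trace = 0 := by
      rw [mul_sub, trace_sub, ← mul_assoc, ← mul_assoc, hED.eq, mul_assoc, trace_mul_comm D,
        sub_self]
    rw [← trace_conjTranspose_mul_self_eq_zero_iff]
    nth_rewrite 1 [← hYZ]
    rw [conjTranspose_add, add_mul, trace_add, orth hYA, hAB, ← neg_sub, mul_neg, trace_neg,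
      orth hZB, neg_zero, add_zero]
  have hle := Submodule.finrank_add_finrank_le_of_disjoint hdisj
  have hdim : Module.finrank ℂ (Matrix (Fin n) (Fin n) ℂ) = n ^ 2 := by
    rw [Module.finrank_matrix]
    simp [sq]
  omega

/-- A nonzero subspace invariant under an irreducible pair of Hermitian matrices is everything. -/
lemma eq_top_of_invariant {n : ℕ} {A B : Matrix (Fin n) (Fin n) ℂ}
    (hA : A.IsHermitian) (hB : B.IsHermitian)
    (hirr : ∀ X, Commute X A → Commute X B → ∃ c : ℂ, X = c • (1 : Matrix (Fin n) (Fin n) ℂ))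
    (W : Submodule ℂ (EuclideanSpace ℂ (Fin n))) (hW : W ≠ ⊥)
    (hAW : ∀ w ∈ W, toLpLinAlgEquiv 2 A w ∈ W) (hBW : ∀ w ∈ W, toLpLinAlgEquiv 2 B w ∈ W) :
    W = ⊤ := by
  have comm {D : Matrix (Fin n) (Fin n) ℂ} (hD : D.IsHermitian)
      (hDW : ∀ w ∈ W, toLpLinAlgEquiv 2 D w ∈ W) :
      Commute (W.starProjection : Module.End ℂ (EuclideanSpace ℂ (Fin n)))
        (toLpLinAlgEquiv 2 D) := by
    have hidem : IsIdempotentElem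
        (W.starProjection : Module.End ℂ (EuclideanSpace ℂ (Fin n))) :=
      congrArg ContinuousLinearMap.toLinearMap W.isIdempotentElem_starProjection
    have hsymm : LinearMap.IsSymmetric (toLpLinAlgEquiv 2 D) :=
      isSymmetric_toEuclideanLin_iff.mpr hD
    rw [LinearMap.IsIdempotentElem.commute_iff hidem, W.range_starProjection,
      W.ker_starProjection]
    exact ⟨hDW, hsymm.orthogonalComplement_mem_invtSubmodule hDW⟩
  obtain ⟨c, hc⟩ := hirr ((toLpLinAlgEquiv 2).symm W.starProjection.toLinearMap)
    (by simpa using (comm hA hAW).map (toLpLinAlgEquiv (R := ℂ) 2).symm)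
    (by simpa using (comm hB hBW).map (toLpLinAlgEquiv (R := ℂ) 2).symm)
  have hproj : (W.starProjection : Module.End ℂ (EuclideanSpace ℂ (Fin n))) = c • 1 := by
    rw [AlgEquiv.symm_apply_eq] at hc
    rw [hc, map_smul, map_one]
  have happly (w : EuclideanSpace ℂ (Fin n)) : W.starProjection w = c • w :=
    congrArg (fun g : Module.End ℂ (EuclideanSpace ℂ (Fin n)) => g w) hproj
  obtain ⟨v, hv, hv0⟩ := W.exists_mem_ne_zero_of_ne_bot hW
  have hc1 : c = 1 := by
    have := Submodule.starProjection_eq_self_iff.mpr hv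
    rw [happly] at this
    by_contra hne
    have : (c - 1) • v = 0 := by rw [sub_smul, this, one_smul, sub_self]
    exact hv0 ((smul_eq_zero.mp this).resolve_left (sub_ne_zero.mpr hne))
  refine eq_top_iff.mpr fun w _ => ?_
  rw [← Submodule.starProjection_eq_self_iff, happly, hc1, one_smul]

/-- In an irreducible triple on the balanced hyperplane, the kernel of the first matrix is at most
one-dimensional. -/
lemma rank_one_sub_sub_le_one {n : ℕ} {P₁ P₂ Q₁ Q₂ S₁ S₂ : Matrix (Fin n) (Fin n) ℂ}
    {a₁ a₂ b₁ b₂ d₁ d₂ g : ℂ} (hP₁ : IsProjection P₁) (hP₂ : IsProjection P₂)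
    (hQ₁ : IsProjection Q₁) (hQ₂ : IsProjection Q₂) (hS₁ : IsProjection S₁)
    (hS₂ : IsProjection S₂) (hP : P₁ * P₂ = 0) (hQ : Q₁ * Q₂ = 0) (hS : S₁ * S₂ = 0)
    (hA : (a₁ • P₁ + a₂ • P₂).IsHermitian) (hB : (b₁ • Q₁ + b₂ • Q₂).IsHermitian)
    (ha₁ : a₁ ≠ 0) (ha₂ : a₂ ≠ 0)
    (hsum : (a₁ • P₁ + a₂ • P₂) + (b₁ • Q₁ + b₂ • Q₂) + (d₁ • S₁ + d₂ • S₂) =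
      g • (1 : Matrix (Fin n) (Fin n) ℂ))
    (hbal : a₁ + a₂ + b₁ + b₂ + d₁ + d₂ = 3 * g)
    (hirr : ∀ X, Commute X (a₁ • P₁ + a₂ • P₂) → Commute X (b₁ • Q₁ + b₂ • Q₂) →
      ∃ c : ℂ, X = c • (1 : Matrix (Fin n) (Fin n) ℂ)) :
    (1 - P₁ - P₂).rank ≤ 1 := by
  have hAA := hP₁.combination_mul_self (a := a₁) (b := a₂) hP₂ hP
  have hBB := hQ₁.combination_cube (a := b₁) (b := b₂) hQ₂ hQ
  have hCC := hS₁.combination_cube (a := d₁) (b := d₂) hS₂ hS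
  have hRA := hP₁.one_sub_sub_mul_combination (a := a₁) (b := a₂) hP₂ hP
  have hAR := hP₁.combination_mul_one_sub_sub (a := a₁) (b := a₂) hP₂ hP
  have hR := hP₁.one_sub_sub hP₂ hP
  set A := a₁ • P₁ + a₂ • P₂
  set B := b₁ • Q₁ + b₂ • Q₂
  set C := d₁ • S₁ + d₂ • S₂
  set R := 1 - P₁ - P₂
  have hC : C = g • (1 : Matrix (Fin n) (Fin n) ℂ) - (A + B) := by rw [← hsum]; abel
  have hAB : (A + B) * ((A + B) * (A + B)) = (a₁ + a₂ + (b₁ + b₂)) • ((A + B) * (A + B)) +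
      (2 * g * (d₁ + d₂) - 3 * g ^ 2 - d₁ * d₂) • (A + B) +
      (g ^ 3 - (d₁ + d₂) * g ^ 2 + d₁ * d₂ * g) • (1 : Matrix (Fin n) (Fin n) ℂ) := by
    have hcoef : a₁ + a₂ + (b₁ + b₂) = 3 * g - (d₁ + d₂) := by linear_combination hbal
    rw [hcoef]
    generalize A + B = D at hC
    rw [hC] at hCC
    simp only [mul_sub, sub_mul, smul_mul_assoc, mul_smul_comm, mul_one, one_mul] at hCC
    linear_combination (norm := module) -hCC
  by_cases hR0 : R = 0
  · simp [hR0]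
  have hpair : BalancedPair (a₁ + a₂) (a₁ * a₂) (b₁ + b₂) (-(b₁ * b₂))
      (2 * g * (d₁ + d₂) - 3 * g ^ 2 - d₁ * d₂) (g ^ 3 - (d₁ + d₂) * g ^ 2 + d₁ * d₂ * g)
      (toLpLinAlgEquiv 2 A) (toLpLinAlgEquiv 2 B) (toLpLinAlgEquiv 2 R) := by
    have transfer {M N : Matrix (Fin n) (Fin n) ℂ} (h : M = N)
        (w : EuclideanSpace ℂ (Fin n)) :
        toLpLinAlgEquiv 2 M w = toLpLinAlgEquiv 2 N w := by rw [h]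
    refine ⟨fun w => ?_, fun w => ?_, fun w => ?_, fun w => ?_, fun w => ?_, fun w => ?_⟩
    · simpa only [map_mul, Module.End.mul_apply] using transfer hR.2 w
    · simpa only [map_mul, Module.End.mul_apply, map_zero, LinearMap.zero_apply] using
        transfer hRA w
    · simpa only [map_mul, Module.End.mul_apply, map_zero, LinearMap.zero_apply] using
        transfer hAR w
    · simpa only [map_mul, map_add, map_sub, map_smul, map_one, Module.End.mul_apply,
        LinearMap.add_apply, LinearMap.sub_apply, LinearMap.smul_apply, Module.End.one_apply]
        using transfer hAA w
    · simpa only [map_mul, map_add, map_smul, Module.End.mul_apply,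
        LinearMap.add_apply, LinearMap.smul_apply] using transfer hBB w
    · have := transfer hAB w
      simp only [map_mul, map_add, map_smul, map_one, Module.End.mul_apply,
        LinearMap.add_apply, LinearMap.smul_apply, Module.End.one_apply] at this
      linear_combination (norm := module) this
  obtain ⟨v, hv0, W, hvW, hxW, hyW, hRW⟩ := hpair.exists_invariant_submodule
    (mul_ne_zero ha₁ ha₂) (by simpa using hR0)
  have hW : W = ⊤ := eq_top_of_invariant hA hB hirr W
    (fun hbot => hv0 ((Submodule.mem_bot ℂ).mp (hbot ▸ hvW))) hxW hyW
  have hrange : LinearMap.range (toLpLinAlgEquiv 2 R) ≤ Submodule.span ℂ {v} := by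
    rintro _ ⟨w, rfl⟩
    exact hRW w (hW ▸ Submodule.mem_top)
  have hrank : R.rank = Module.finrank ℂ (LinearMap.range (toLpLinAlgEquiv 2 R)) :=
    R.rank_eq_finrank_range_toLin (PiLp.basisFun 2 ℂ (Fin n)) (PiLp.basisFun 2 ℂ (Fin n))
  rw [hrank]
  exact (Submodule.finrank_mono hrange).trans ((finrank_span_le_card _).trans (by simp))

/-- Three partitions of `N` into three parts have total square sum at least `N²`, with equality
only if all parts are equal. -/
lemma parts_eq_of_sum_sq_eq {a₁ a₂ a₃ b₁ b₂ b₃ c₁ c₂ c₃ N : ℤ} (ha : a₁ + a₂ + a₃ = N)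
    (hb : b₁ + b₂ + b₃ = N) (hc : c₁ + c₂ + c₃ = N)
    (h : a₁ ^ 2 + a₂ ^ 2 + a₃ ^ 2 + (b₁ ^ 2 + b₂ ^ 2 + b₃ ^ 2) + (c₁ ^ 2 + c₂ ^ 2 + c₃ ^ 2) ≤
      N ^ 2) :
    (a₁ = a₃ ∧ a₂ = a₃) ∧ (b₁ = b₃ ∧ b₂ = b₃) ∧ c₁ = c₃ ∧ c₂ = c₃ := by
  have variance (u₁ u₂ u₃ : ℤ) (hu : u₁ + u₂ + u₃ = N) :
      3 * (u₁ ^ 2 + u₂ ^ 2 + u₃ ^ 2) - N ^ 2 =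
        (u₁ - u₂) ^ 2 + (u₁ - u₃) ^ 2 + (u₂ - u₃) ^ 2 := by
    rw [← hu]
    ring
  have zero_of (u : ℤ) (hu : u ^ 2 ≤ 0) : u = 0 := by
    simpa using le_antisymm hu (sq_nonneg u)
  have va := variance _ _ _ ha
  have vb := variance _ _ _ hb
  have vc := variance _ _ _ hc
  have n₁ := sq_nonneg (a₁ - a₂)
  have n₂ := sq_nonneg (a₁ - a₃)
  have n₃ := sq_nonneg (a₂ - a₃)
  have n₄ := sq_nonneg (b₁ - b₂)
  have n₅ := sq_nonneg (b₁ - b₃)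
  have n₆ := sq_nonneg (b₂ - b₃)
  have n₇ := sq_nonneg (c₁ - c₂)
  have n₈ := sq_nonneg (c₁ - c₃)
  have n₉ := sq_nonneg (c₂ - c₃)
  exact ⟨⟨sub_eq_zero.mp (zero_of _ (by linarith)), sub_eq_zero.mp (zero_of _ (by linarith))⟩,
    ⟨sub_eq_zero.mp (zero_of _ (by linarith)), sub_eq_zero.mp (zero_of _ (by linarith))⟩,
    sub_eq_zero.mp (zero_of _ (by linarith)), sub_eq_zero.mp (zero_of _ (by linarith))⟩

/-- In the hyperplane case `α1+α2+β1+β2+δ1+δ2 = 3γ`, the generalized dimension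
of an irreducible non-degenerate *-representation of `A(Ẽ6,χ)` is either
`(1,1,1,1,1,1,3)`, or the corresponding graph dimension vector
`d = (n2, n1+n2, n4, n3+n4, n6, n5+n6, n0)` is a real root of the Tits form. -/
theorem repE6_hyperplane_dims (α1 α2 β1 β2 δ1 δ2 γ : ℝ)
    (hα1 : α2 < α1) (hα2 : 0 < α2) (hβ1 : β2 < β1) (hβ2 : 0 < β2)
    (hδ1 : δ2 < δ1) (hδ2 : 0 < δ2) (hγ : 0 < γ)
    (hsum : α1 + α2 + β1 + β2 + δ1 + δ2 = 3 * γ)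
    (n : Fin 7 → ℕ) (hrep : HasIrrNondegRep α1 α2 β1 β2 δ1 δ2 γ n) :
    n = ![1, 1, 1, 1, 1, 1, 3] ∨
      titsE6 ![(n 1 : ℤ), (n 0 : ℤ) + n 1, (n 3 : ℤ), (n 2 : ℤ) + n 3,
               (n 5 : ℤ), (n 4 : ℤ) + n 5, (n 6 : ℤ)] = 1 := by
  obtain ⟨hpos, P1, P2, Q1, Q2, S1, S2, ⟨hP1, hP2, hQ1, hQ2, hS1, hS2, hP, hQ, hS, r1, r2, r3, r4,
    r5, r6, hrel⟩, -, hirr⟩ := hrep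
  have ne_zero {u : ℝ} (hu : 0 < u) : (u : ℂ) ≠ 0 := Complex.ofReal_ne_zero.mpr hu.ne'
  have ne_of {u w : ℝ} (huw : w < u) : (u : ℂ) ≠ w := fun h =>
    huw.ne' (Complex.ofReal_injective h)
  have hermitian (u w : ℝ) {M N : Matrix (Fin (n 6)) (Fin (n 6)) ℂ} (hM : IsProjection M)
      (hN : IsProjection N) : ((u : ℂ) • M + (w : ℂ) • N).IsHermitian := by
    simp [Matrix.IsHermitian, hM.1.eq, hN.1.eq]
  have hα0 := ne_zero (hα2.trans hα1)
  have hβ0 := ne_zero (hβ2.trans hβ1)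
  have hδ0 := ne_zero (hδ2.trans hδ1)
  have hsum' : ((α1 : ℂ) • P1 + (α2 : ℂ) • P2) + ((β1 : ℂ) • Q1 + (β2 : ℂ) • Q2) +
      ((δ1 : ℂ) • S1 + (δ2 : ℂ) • S2) = (γ : ℂ) • (1 : Matrix (Fin (n 6)) (Fin (n 6)) ℂ) := by
    rw [← hrel]
    abel
  have hirr' : ∀ X, Commute X ((α1 : ℂ) • P1 + (α2 : ℂ) • P2) →
      Commute X ((β1 : ℂ) • Q1 + (β2 : ℂ) • Q2) →
      ∃ c : ℂ, X = c • (1 : Matrix (Fin (n 6)) (Fin (n 6)) ℂ) := by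
    intro X hXA hXB
    have hXC : Commute X ((δ1 : ℂ) • S1 + (δ2 : ℂ) • S2) := by
      rw [← eq_sub_iff_add_eq'] at hsum'
      rw [hsum']
      exact ((Commute.one_right X).smul_right _).sub_right (hXA.add_right hXB)
    obtain ⟨hX1, hX2⟩ := hP1.commute_of_commute_combination hP2 hP hα0 (ne_zero hα2) (ne_of hα1) hXA
    obtain ⟨hX3, hX4⟩ := hQ1.commute_of_commute_combination hQ2 hQ hβ0 (ne_zero hβ2) (ne_of hβ1) hXB
    obtain ⟨hX5, hX6⟩ := hS1.commute_of_commute_combination hS2 hS hδ0 (ne_zero hδ2) (ne_of hδ1) hXC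
    exact hirr X hX1 hX2 hX3 hX4 hX5 hX6
  have hbound := sum_finrank_ker_innerDerivation_le (hermitian α1 α2 hP1 hP2)
    (hermitian β1 β2 hQ1 hQ2) hsum' hirr'
  rw [finrank_ker_innerDerivation hP1 hP2 hP hα0 (ne_zero hα2) (ne_of hα1),
    finrank_ker_innerDerivation hQ1 hQ2 hQ hβ0 (ne_zero hβ2) (ne_of hβ1),
    finrank_ker_innerDerivation hS1 hS2 hS hδ0 (ne_zero hδ2) (ne_of hδ1)] at hbound
  have hrank := rank_one_sub_sub_le_one hP1 hP2 hQ1 hQ2 hS1 hS2 hP hQ hS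
    (hermitian α1 α2 hP1 hP2) (hermitian β1 β2 hQ1 hQ2) hα0 (ne_zero hα2) hsum'
    (by exact_mod_cast hsum) hirr'
  have dimP := hP1.rank_one_sub_sub hP2 hP
  have dimQ := hQ1.rank_one_sub_sub hQ2 hQ
  have dimS := hS1.rank_one_sub_sub hS2 hS
  rw [r1, r2] at dimP hbound
  rw [r3, r4] at dimQ hbound
  rw [r5, r6] at dimS hbound
  generalize (1 - P1 - P2).rank = a at *
  generalize (1 - Q1 - Q2).rank = b at *
  generalize (1 - S1 - S2).rank = c at *
  zify at dimP dimQ dimS hbound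
  have htits : 2 * titsE6 ![(n 1 : ℤ), (n 0 : ℤ) + n 1, (n 3 : ℤ), (n 2 : ℤ) + n 3,
      (n 5 : ℤ), (n 4 : ℤ) + n 5, (n 6 : ℤ)] =
      (n 0 : ℤ) ^ 2 + (n 1 : ℤ) ^ 2 + (a : ℤ) ^ 2 +
        ((n 2 : ℤ) ^ 2 + (n 3 : ℤ) ^ 2 + (b : ℤ) ^ 2) +
        ((n 4 : ℤ) ^ 2 + (n 5 : ℤ) ^ 2 + (c : ℤ) ^ 2) - (n 6 : ℤ) ^ 2 := by
    have ea : (a : ℤ) = n 6 - n 0 - n 1 := by linarith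
    have eb : (b : ℤ) = n 6 - n 2 - n 3 := by linarith
    have ec : (c : ℤ) = n 6 - n 4 - n 5 := by linarith
    rw [ea, eb, ec]
    simp [titsE6]
    ring
  by_cases hone : titsE6 ![(n 1 : ℤ), (n 0 : ℤ) + n 1, (n 3 : ℤ), (n 2 : ℤ) + n 3,
      (n 5 : ℤ), (n 4 : ℤ) + n 5, (n 6 : ℤ)] = 1
  · exact Or.inr hone
  left
  have hle : titsE6 ![(n 1 : ℤ), (n 0 : ℤ) + n 1, (n 3 : ℤ), (n 2 : ℤ) + n 3,
      (n 5 : ℤ), (n 4 : ℤ) + n 5, (n 6 : ℤ)] ≤ 0 := by omega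
  obtain ⟨⟨h0, h1⟩, ⟨h2, h3⟩, h4, h5⟩ := parts_eq_of_sum_sq_eq dimP dimQ dimS (by linarith)
  have hn0 := hpos 0
  ext i
  fin_cases i <;> simp <;> omega
end
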